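/- For every κ > 0 there exist ε > 0, C > 0, and R₀ > 0 such that for every integer R ≥ R₀ the following holds: let A := {(x,y) ∈ ℤ² : x² + y² = R}; if |A| > exp((log R)^{1−ε}), then the number of six-tuples (z₁, z₂, z₃, z₄, z₅, z₆) ∈ A⁶ with z₁ + z₂ + z₃ = z₄ + z₅ + z₆ (addition in ℤ²) is at most C · |A|^{3+κ}. -/

import Mathlib

open MeasureTheory

noncomputable section

/-- The weight `w_B` attached to the axis-parallel square of center `c` and side length `R`:
`w_B(x) = (1 + |x - c|/R)^(-100)` with `|·|` the Euclidean norm on `ℝ²`. -/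
def wB (c : ℝ × ℝ) (R : ℝ) (x : ℝ × ℝ) : ℝ :=
  (1 + Real.sqrt ((x.1 - c.1) ^ 2 + (x.2 - c.2) ^ 2) / R) ^ (-100 : ℤ)

/-- The product weight `w̃_B(x) = (1 + |x₁ - c₁|/R)^(-100) * (1 + |x₂ - c₂|/R)^(-100)`. -/
def wtB (c : ℝ × ℝ) (R : ℝ) (x : ℝ × ℝ) : ℝ :=
  (1 + |x.1 - c.1| / R) ^ (-100 : ℤ) * (1 + |x.2 - c.2| / R) ^ (-100 : ℤ)

/-- The axis-parallel square `B(c, R)` with center `c` and side length `R`, as a subset of `ℝ²`. -/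
def sqr (c : ℝ × ℝ) (R : ℝ) : Set (ℝ × ℝ) :=
  Set.Icc (c.1 - R / 2) (c.1 + R / 2) ×ˢ Set.Icc (c.2 - R / 2) (c.2 + R / 2)

/-- The extension operator associated to the parabola, over the interval `[a, b]`:
`(E_{[a,b]} g)(x) = ∫_{[a,b]} g(ξ) e(ξ x₁ + ξ² x₂) dξ`. -/
def extOp (a b : ℝ) (g : ℝ → ℂ) (x : ℝ × ℝ) : ℂ :=
  ∫ ξ in Set.Icc a b,
    g ξ * Complex.exp (2 * Real.pi * Complex.I * ((ξ * x.1 + ξ ^ 2 * x.2 : ℝ) : ℂ))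

/-- Weighted `L^p` norm `‖f‖_{L^p(w)} = (∫_{ℝ²} |f|^p w)^{1/p}`. -/
def wLp (p : ℝ) (w : ℝ × ℝ → ℝ) (f : ℝ × ℝ → ℂ) : ℝ :=
  (∫ x : ℝ × ℝ, ‖f x‖ ^ p * w x) ^ (1 / p)

/-- `L^p` norm over the square of center `c` and side `R`. -/
def sqLp (p : ℝ) (c : ℝ × ℝ) (R : ℝ) (f : ℝ × ℝ → ℂ) : ℝ :=
  (∫ x in sqr c R, ‖f x‖ ^ p) ^ (1 / p)

/-- Normalized weighted `L^p` norm `‖f‖_{L^p_#(w)} = (|B|⁻¹ ∫_{ℝ²} |f|^p w)^{1/p}` where the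
normalizing square has side length `R` (so `|B| = R²`). -/
def shLp (p R : ℝ) (w : ℝ × ℝ → ℝ) (f : ℝ × ℝ → ℂ) : ℝ :=
  ((R ^ 2)⁻¹ * ∫ x : ℝ × ℝ, ‖f x‖ ^ p * w x) ^ (1 / p)

/-- Normalized `L^p` norm over the square of center `c` and side `R`:
`‖f‖_{L^p_#(B)} = (|B|⁻¹ ∫_B |f|^p)^{1/p}`. -/
def shLpSq (p : ℝ) (c : ℝ × ℝ) (R : ℝ) (f : ℝ × ℝ → ℂ) : ℝ :=
  ((R ^ 2)⁻¹ * ∫ x in sqr c R, ‖f x‖ ^ p) ^ (1 / p)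

/-- `DecIneq p n D` says that the constant `D` is admissible in the `l²L^p` decoupling
inequality for the parabola at scale `δ = 1/n`: for every integrable `g : [0,1] → ℂ` and every
axis-parallel square `B` of side length `δ⁻² = n²`,
`‖E_{[0,1]} g‖_{L^p(B)} ≤ D (Σ_{J ∈ P_δ([0,1])} ‖E_J g‖_{L^p(w_B)}²)^{1/2}`. -/
def DecIneq (p : ℝ) (n : ℕ) (D : ℝ) : Prop :=
  ∀ g : ℝ → ℂ, IntegrableOn g (Set.Icc 0 1) → ∀ c : ℝ × ℝ,
    sqLp p c ((n : ℝ) ^ 2) (extOp 0 1 g) ≤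
      D * (∑ k ∈ Finset.range n,
        wLp p (wB c ((n : ℝ) ^ 2)) (extOp ((k : ℝ) / (n : ℝ)) (((k : ℝ) + 1) / (n : ℝ)) g) ^ 2)
        ^ (1 / 2 : ℝ)

/-- The decoupling constant `D_p(δ)` for the parabola at scale `δ = 1/n`, i.e. the smallest
admissible constant in the decoupling inequality. -/
def Dconst (p : ℝ) (n : ℕ) : ℝ := sInf {D : ℝ | 0 ≤ D ∧ DecIneq p n D}

/-- Center of the `(i,j)` square in the partition of the axis-parallel square of center `c` and
side length `Rb` into axis-parallel squares of side length `r`. -/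
def subCtr (c : ℝ × ℝ) (Rb r : ℝ) (i j : ℕ) : ℝ × ℝ :=
  (c.1 - Rb / 2 + ((i : ℝ) + 1 / 2) * r, c.2 - Rb / 2 + ((j : ℝ) + 1 / 2) * r)

/-- `BilIneq p n k b M` says `M` is admissible in the bilinear decoupling inequality with
`δ = 1/n`, `ν = 1/k`: for every square `B` of side `δ⁻² = n²`, every integrable `g`, and all
`ν`-separated intervals `I = [i/k, (i+1)/k]`, `I' = [i'/k, (i'+1)/k]` of the partition
`P_ν([0,1])`,
`Avg_{Δ ∈ P_{ν^{-b}}(B)} Π (Σ_{J ∈ P_{ν^b}} ‖E_J g‖_{L²_#(w̃_Δ)}²)^{p/4}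
  ≤ M^p Π (Σ_{J ∈ P_δ} ‖E_J g‖_{L^p_#(w_B)}²)^{p/4}`. -/
def BilIneq (p : ℝ) (n k b : ℕ) (M : ℝ) : Prop :=
  ∀ g : ℝ → ℂ, IntegrableOn g (Set.Icc 0 1) → ∀ c : ℝ × ℝ,
    ∀ i i' : ℕ, i < k → i' < k → (i + 1 < i' ∨ i' + 1 < i) →
    (((n ^ 2 / k ^ b : ℕ) : ℝ) ^ 2)⁻¹ *
        ∑ a ∈ Finset.range (n ^ 2 / k ^ b), ∑ a' ∈ Finset.range (n ^ 2 / k ^ b),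
          ((∑ J ∈ Finset.range (k ^ (b - 1)),
              shLp 2 ((k : ℝ) ^ b)
                (wtB (subCtr c ((n : ℝ) ^ 2) ((k : ℝ) ^ b) a a') ((k : ℝ) ^ b))
                (extOp ((i : ℝ) / (k : ℝ) + (J : ℝ) / (k : ℝ) ^ b)
                  ((i : ℝ) / (k : ℝ) + ((J : ℝ) + 1) / (k : ℝ) ^ b) g) ^ 2) ^ (p / 4) *
            (∑ J ∈ Finset.range (k ^ (b - 1)),
              shLp 2 ((k : ℝ) ^ b)
                (wtB (subCtr c ((n : ℝ) ^ 2) ((k : ℝ) ^ b) a a') ((k : ℝ) ^ b))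
                (extOp ((i' : ℝ) / (k : ℝ) + (J : ℝ) / (k : ℝ) ^ b)
                  ((i' : ℝ) / (k : ℝ) + ((J : ℝ) + 1) / (k : ℝ) ^ b) g) ^ 2) ^ (p / 4))
      ≤ M ^ p *
        ((∑ J ∈ Finset.range (n / k),
            shLp p ((n : ℝ) ^ 2) (wB c ((n : ℝ) ^ 2))
              (extOp ((i : ℝ) / (k : ℝ) + (J : ℝ) / (n : ℝ))
                ((i : ℝ) / (k : ℝ) + ((J : ℝ) + 1) / (n : ℝ)) g) ^ 2) ^ (p / 4) *
          (∑ J ∈ Finset.range (n / k),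
            shLp p ((n : ℝ) ^ 2) (wB c ((n : ℝ) ^ 2))
              (extOp ((i' : ℝ) / (k : ℝ) + (J : ℝ) / (n : ℝ))
                ((i' : ℝ) / (k : ℝ) + ((J : ℝ) + 1) / (n : ℝ)) g) ^ 2) ^ (p / 4))

/-- The bilinear decoupling constant `M_{p,b}(δ, ν)` with `δ = 1/n`, `ν = 1/k`. -/
def Mconst (p : ℝ) (n k b : ℕ) : ℝ := sInf {M : ℝ | 0 ≤ M ∧ BilIneq p n k b M}

/-- The Fourier transform of a function on `ℝ²`. -/
def ftR2 (η : ℝ × ℝ → ℝ) (ξ : ℝ × ℝ) : ℂ :=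
  ∫ x : ℝ × ℝ, (η x : ℂ) * Complex.exp (-(2 * Real.pi * Complex.I) * ((x.1 * ξ.1 + x.2 * ξ.2 : ℝ) : ℂ))

end

section CapTree

open scoped Classical

/-- Almost orthogonality of functions which are multiplied by distinct characters under the
translations by a subgroup. -/
lemma sum_subgroup_norm_sq {G J : Type*} [AddCommGroup G] [Fintype G] (D : AddSubgroup G)
    (s : Finset J) (ψ : J → AddChar G ℂ) (a : J → ℂ)
    (hsep : ∀ i ∈ s, ∀ j ∈ s, i ≠ j → ∃ y ∈ D, ψ i y ≠ ψ j y) :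
    ∑ y : D, ‖∑ i ∈ s, ψ i y * a i‖ ^ 2 = Fintype.card D * ∑ i ∈ s, ‖a i‖ ^ 2 := by
  have horth : ∀ i ∈ s, ∀ j ∈ s,
      ∑ y : D, ψ i y * (starRingEnd ℂ) (ψ j y) = if i = j then (Fintype.card D : ℂ) else 0 := by
    intro i hi j hj
    split_ifs with h
    · subst h
      simp [Complex.mul_conj', AddChar.norm_apply]
    · obtain ⟨y, hy, hne⟩ := hsep i hi j hj h
      have key := AddChar.sum_eq_zero_of_ne_one
        (ψ := (ψ i * (ψ j)⁻¹).compAddMonoidHom D.subtype) (by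
          intro h1
          have := DFunLike.congr_fun h1 (⟨y, hy⟩ : D)
          simp only [AddChar.compAddMonoidHom_apply, AddSubgroup.subtype_apply, AddChar.mul_apply,
            AddChar.inv_apply', AddChar.one_apply] at this
          have h0 : ψ j y ≠ 0 := by
            intro h0
            have := AddChar.norm_apply (ψ j) y
            simp [h0] at this
          apply hne
          field_simp at this
          exact this)
      rw [← key]
      refine Finset.sum_congr rfl fun y _ => ?_
      simp [AddChar.mul_apply, AddChar.inv_apply, AddChar.map_neg_eq_conj]
  have hC : ((∑ y : D, ‖∑ i ∈ s, ψ i y * a i‖ ^ 2 : ℝ) : ℂ) =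
      ((Fintype.card D * ∑ i ∈ s, ‖a i‖ ^ 2 : ℝ) : ℂ) := by
    push_cast
    simp_rw [← Complex.mul_conj', map_sum, map_mul, Finset.sum_mul_sum]
    rw [Finset.sum_comm, Finset.mul_sum]
    refine Finset.sum_congr rfl fun i hi => ?_
    rw [Finset.sum_comm]
    have : ∀ j ∈ s, ∑ y : D, ψ i y * a i * ((starRingEnd ℂ) (ψ j y) * (starRingEnd ℂ) (a j)) =
        if i = j then (Fintype.card D : ℂ) * (a i * (starRingEnd ℂ) (a j)) else 0 := by
      intro j hj
      have h1 : ∀ y : D, ψ i y * a i * ((starRingEnd ℂ) (ψ j y) * (starRingEnd ℂ) (a j)) =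
          (ψ i y * (starRingEnd ℂ) (ψ j y)) * (a i * (starRingEnd ℂ) (a j)) := fun y => by ring
      simp_rw [h1]
      rw [← Finset.sum_mul, horth i hi j hj]
      split_ifs <;> simp
    rw [Finset.sum_congr rfl this, Finset.sum_ite_eq, if_pos hi]
  exact_mod_cast hC

lemma sum_subgroup_translate {G : Type*} [AddCommGroup G] [Fintype G] (D : AddSubgroup G)
    (F : G → ℝ) : ∑ x, ∑ y : D, F (x + y) = Fintype.card D * ∑ x, F x := by
  rw [Finset.sum_comm]
  have : ∀ y : D, ∑ x, F (x + y) = ∑ x, F x := fun y =>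
    Fintype.sum_equiv (Equiv.addRight (y : G)) _ _ fun _ => rfl
  simp [this]

/-- Truncation of a complex number at absolute value `lam`. -/
noncomputable def truncNorm (lam : ℝ) (z : ℂ) : ℂ := if ‖z‖ ≤ lam then z else 0

lemma truncNorm_mul {lam : ℝ} {c : ℂ} (hc : ‖c‖ = 1) (z : ℂ) :
    truncNorm lam (c * z) = c * truncNorm lam z := by
  simp [truncNorm, hc]

lemma norm_truncNorm_le (lam : ℝ) (z : ℂ) : ‖truncNorm lam z‖ ≤ ‖z‖ := by
  unfold truncNorm; split_ifs <;> simp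

lemma norm_truncNorm_le' {lam : ℝ} (h : 0 ≤ lam) (z : ℂ) : ‖truncNorm lam z‖ ≤ lam := by
  unfold truncNorm; split_ifs <;> simp_all

lemma norm_sub_truncNorm_le {lam : ℝ} (h : 0 < lam) (z : ℂ) :
    ‖truncNorm lam z - z‖ ≤ ‖z‖ ^ 2 / lam := by
  unfold truncNorm
  split_ifs with hz
  · simp; positivity
  · push Not at hz
    rw [zero_sub, norm_neg, le_div_iff₀ h]
    nlinarith [norm_nonneg z]

/-- Characters `chi z` of a finite group with a nested family of partitions into classes
`cls m` (finest for `m = 0`), which behave like the caps of a curved arc. -/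
structure CapTree (G ι K : Type*) [AddCommGroup G] [Fintype G] [Fintype ι] where
  chi : ι → AddChar G ℂ
  cls : ℕ → ι → K
  par : ℕ → K → K
  anc : K → K
  n : ℕ
  b : ℕ
  D : ℕ → AddSubgroup G
  H : ℕ → AddSubgroup G
  par_cls : ∀ m z, par m (cls m z) = cls (m + 1) z
  anc_cls : ∀ m ≤ n, ∀ z, anc (cls m z) = cls n z
  cls_injective : Function.Injective (cls 0)
  card_children : ∀ m < n, ∀ κ, ((Finset.univ.image (cls m)).filter (par m · = κ)).card ≤ b
  card_top : (Finset.univ.image (cls n)).card ≤ b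
  D_stab : ∀ m < n, ∀ y ∈ D m, ∀ z z', cls m z = cls m z' → chi z y = chi z' y
  D_sep : ∀ m < n, ∀ z z', cls m z ≠ cls m z' → ∃ y ∈ D m, chi z y ≠ chi z' y
  D_le : ∀ m < n, ∀ κ₁ ∈ Finset.univ.image (cls (m + 1)),
    ∀ κ₂ ∈ Finset.univ.image (cls (m + 1)), κ₁ ≠ κ₂ → ∀ y ∈ D m, ∃ t₁ t₂, y = t₁ + t₂ ∧
      (∀ z z', cls (m + 1) z = κ₁ → cls (m + 1) z' = κ₁ → chi z t₁ = chi z' t₁) ∧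
      (∀ z z', cls (m + 1) z = κ₂ → cls (m + 1) z' = κ₂ → chi z t₂ = chi z' t₂)
  H_stab : ∀ m, 1 ≤ m → m ≤ n → ∀ y ∈ H m, ∀ z z', cls m z = cls m z' → chi z y = chi z' y
  H_sep : ∀ m, 1 ≤ m → m ≤ n → ∀ z₁ z₂ w₁ w₂, cls n z₁ = cls n z₂ → cls n w₁ = cls n w₂ →
    cls n z₁ ≠ cls n w₁ → (∀ y ∈ H m, chi z₁ y * chi w₁ y = chi z₂ y * chi w₂ y) →
    cls m z₁ = cls m z₂ ∧ cls m w₁ = cls m w₂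

namespace CapTree

variable {G ι K : Type*} [AddCommGroup G] [Fintype G] [Fintype ι] (t : CapTree G ι K)

/-- The set of classes of level `m`. -/
noncomputable def classes (m : ℕ) : Finset K := Finset.univ.image (t.cls m)

/-- Translations on which all characters of a class agree. -/
def Stab (m : ℕ) (κ : K) (y : G) : Prop :=
  ∀ z z', t.cls m z = κ → t.cls m z' = κ → t.chi z y = t.chi z' y

/-- The sum of the characters in a class, with the large wave packets of finer levels removed. -/
noncomputable def pruned (lam : ℝ) : ℕ → K → G → ℂ
  | 0, κ, x => ∑ z with t.cls 0 z = κ, t.chi z x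
  | m + 1, κ, x => ∑ κ' ∈ t.classes m with t.par m κ' = κ, truncNorm lam (pruned lam m κ' x)

/-- The square function of level `m`. -/
noncomputable def sqFun (lam : ℝ) (m : ℕ) (x : G) : ℝ := ∑ κ ∈ t.classes m, ‖t.pruned lam m κ x‖ ^ 2

/-- The high frequency part of `‖pruned lam (m + 1) κ‖ ^ 2`. -/
noncomputable def high (lam : ℝ) (m : ℕ) (κ : K) (x : G) : ℝ :=
  ‖t.pruned lam (m + 1) κ x‖ ^ 2 -
    ∑ κ' ∈ t.classes m with t.par m κ' = κ, ‖truncNorm lam (t.pruned lam m κ' x)‖ ^ 2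

/-- The part of the pruned sum of level `m` coming from the top class `c`. -/
noncomputable def part (lam : ℝ) (m : ℕ) (c : K) (x : G) : ℂ :=
  ∑ κ ∈ t.classes m with t.anc κ = c, t.pruned lam m κ x

variable {t} {lam : ℝ} {m : ℕ}

lemma mem_classes {κ : K} : κ ∈ t.classes m ↔ ∃ z, t.cls m z = κ := by
  simp [classes]

lemma cls_mem_classes (z : ι) : t.cls m z ∈ t.classes m := mem_classes.2 ⟨z, rfl⟩

lemma par_mem_classes {κ : K} (h : κ ∈ t.classes m) : t.par m κ ∈ t.classes (m + 1) := by
  obtain ⟨z, rfl⟩ := mem_classes.1 h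
  rw [t.par_cls]
  exact cls_mem_classes z

lemma Stab.of_par {κ : K} {y : G} (h : t.Stab (m + 1) (t.par m κ) y) : t.Stab m κ y := by
  rintro z z' rfl hz'
  refine h z z' (t.par_cls m z).symm ?_
  rw [← hz', t.par_cls]

lemma norm_chi (z : ι) (y : G) : ‖t.chi z y‖ = 1 := AddChar.norm_apply _ _

lemma pruned_add (m : ℕ) : ∀ {z : ι} {y : G}, t.Stab m (t.cls m z) y → ∀ x,
    t.pruned lam m (t.cls m z) (x + y) = t.chi z y * t.pruned lam m (t.cls m z) x := by
  induction m with
  | zero =>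
    intro z y h x
    simp only [pruned, Finset.mul_sum]
    refine Finset.sum_congr rfl fun z' hz' => ?_
    rw [AddChar.map_add_eq_mul, h z' z (by simpa using hz') rfl, mul_comm]
  | succ m ih =>
    intro z y h x
    simp only [pruned, Finset.mul_sum]
    refine Finset.sum_congr rfl fun κ' hκ' => ?_
    rw [Finset.mem_filter, mem_classes] at hκ'
    obtain ⟨⟨z', rfl⟩, hpar⟩ := hκ'
    rw [ih (Stab.of_par (by rwa [hpar])), truncNorm_mul (norm_chi _ _),
      h z' z (by rw [← t.par_cls, hpar]) rfl]

lemma pruned_add' {κ : K} (hκ : κ ∈ t.classes m) {y : G} (h : t.Stab m κ y) (x : G) :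
    ‖t.pruned lam m κ (x + y)‖ = ‖t.pruned lam m κ x‖ := by
  obtain ⟨z, rfl⟩ := mem_classes.1 hκ
  rw [pruned_add m h, norm_mul, norm_chi, one_mul]

lemma truncNorm_pruned_add {κ : K} (hκ : κ ∈ t.classes m) {y : G} (h : t.Stab m κ y) (x : G) :
    ‖truncNorm lam (t.pruned lam m κ (x + y))‖ = ‖truncNorm lam (t.pruned lam m κ x)‖ := by
  obtain ⟨z, rfl⟩ := mem_classes.1 hκ
  rw [pruned_add m h, truncNorm_mul (norm_chi _ _), norm_mul, norm_chi, one_mul]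

lemma stab_D (hm : m < t.n) {y : G} (hy : y ∈ t.D m) (κ : K) : t.Stab m κ y :=
  fun z z' hz hz' => t.D_stab m hm y hy z z' (hz.trans hz'.symm)

lemma sum_D_pruned (hm : m < t.n) (κ : K) (x : G) :
    ∑ y : t.D m, ‖t.pruned lam (m + 1) κ (x + y)‖ ^ 2 =
      Fintype.card (t.D m) *
        ∑ κ' ∈ t.classes m with t.par m κ' = κ, ‖truncNorm lam (t.pruned lam m κ' x)‖ ^ 2 := by
  rcases isEmpty_or_nonempty ι with hι | hι
  · have : t.classes m = ∅ := by simp [classes]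
    simp [pruned, this]
  have hrep : ∀ κ' ∈ t.classes m, t.cls m (Function.invFun (t.cls m) κ') = κ' := fun κ' h =>
    Function.invFun_eq (mem_classes.1 h)
  rw [← sum_subgroup_norm_sq (t.D m) _ (fun κ' => t.chi (Function.invFun (t.cls m) κ'))
    (fun κ' => truncNorm lam (t.pruned lam m κ' x))]
  · refine Finset.sum_congr rfl fun y _ => ?_
    simp only [pruned]
    congr 2
    refine Finset.sum_congr rfl fun κ' hκ' => ?_
    have h := hrep κ' (Finset.mem_filter.1 hκ').1
    conv_lhs => rw [← h]
    rw [pruned_add m (stab_D hm y.2 _), truncNorm_mul (norm_chi _ _), h]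
  · intro i hi j hj hij
    refine t.D_sep m hm _ _ ?_
    rwa [hrep i (Finset.mem_filter.1 hi).1, hrep j (Finset.mem_filter.1 hj).1]

lemma sum_D_high (hm : m < t.n) (κ : K) (x : G) :
    ∑ y : t.D m, t.high lam m κ (x + y) = 0 := by
  simp only [high, Finset.sum_sub_distrib, sum_D_pruned hm κ x]
  have : ∀ y : t.D m, ∑ κ' ∈ t.classes m with t.par m κ' = κ,
        ‖truncNorm lam (t.pruned lam m κ' (x + y))‖ ^ 2 =
      ∑ κ' ∈ t.classes m with t.par m κ' = κ, ‖truncNorm lam (t.pruned lam m κ' x)‖ ^ 2 := by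
    intro y
    refine Finset.sum_congr rfl fun κ' hκ' => ?_
    rw [truncNorm_pruned_add (Finset.mem_filter.1 hκ').1 (stab_D hm y.2 _)]
  simp [this]

lemma high_add {κ : K} (hκ : κ ∈ t.classes (m + 1)) {y : G} (h : t.Stab (m + 1) κ y) (x : G) :
    t.high lam m κ (x + y) = t.high lam m κ x := by
  simp only [high]
  rw [pruned_add' hκ h]
  congr 1
  refine Finset.sum_congr rfl fun κ' hκ' => ?_
  rw [Finset.mem_filter] at hκ'
  rw [truncNorm_pruned_add hκ'.1 (Stab.of_par (by rwa [hκ'.2]))]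

lemma sum_high_mul_high (hm : m < t.n) {κ₁ κ₂ : K} (h₁ : κ₁ ∈ t.classes (m + 1))
    (h₂ : κ₂ ∈ t.classes (m + 1)) (hne : κ₁ ≠ κ₂) :
    ∑ x, t.high lam m κ₁ x * t.high lam m κ₂ x = 0 := by
  have hshift : ∀ y : t.D m, ∑ x, t.high lam m κ₁ (x + y) * t.high lam m κ₂ x =
      ∑ x, t.high lam m κ₁ x * t.high lam m κ₂ x := by
    intro y
    obtain ⟨a, c, hy, ha, hc⟩ := t.D_le m hm κ₁ h₁ κ₂ h₂ hne y y.2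
    refine Fintype.sum_equiv (Equiv.addRight c) _ _ fun x => ?_
    rw [hy, Equiv.coe_addRight, high_add h₂ hc, add_comm a c, ← add_assoc, high_add h₁ ha]
  have hsum : ∑ y : t.D m, ∑ x, t.high lam m κ₁ (x + y) * t.high lam m κ₂ x = 0 := by
    rw [Finset.sum_comm]
    simp_rw [← Finset.sum_mul, sum_D_high hm, zero_mul, Finset.sum_const_zero]
  simp only [hshift, Finset.sum_const, Finset.card_univ, nsmul_eq_mul, mul_eq_zero] at hsum
  rcases hsum with h | h
  · exact absurd h (by exact_mod_cast Fintype.card_ne_zero)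
  · exact h

lemma sum_truncNorm_le_sqFun (x : G) :
    ∑ κ ∈ t.classes m, ‖truncNorm lam (t.pruned lam m κ x)‖ ^ 2 ≤ t.sqFun lam m x :=
  Finset.sum_le_sum fun _ _ => by gcongr; exact norm_truncNorm_le _ _

lemma sum_children (F : K → ℝ) :
    ∑ κ ∈ t.classes (m + 1), ∑ κ' ∈ t.classes m with t.par m κ' = κ, F κ' =
      ∑ κ' ∈ t.classes m, F κ' :=
  Finset.sum_fiberwise_of_maps_to (fun _ => par_mem_classes) F

lemma sqFun_succ_le (x : G) :
    t.sqFun lam (m + 1) x ≤ ∑ κ ∈ t.classes (m + 1), t.high lam m κ x + t.sqFun lam m x := by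
  simp only [high, Finset.sum_sub_distrib, sum_children]
  have := sum_truncNorm_le_sqFun (t := t) (lam := lam) (m := m) x
  simp only [sqFun] at *
  linarith

lemma sqFun_zero (x : G) : t.sqFun lam 0 x = Fintype.card ι := by
  have h : ∀ z, ‖t.pruned lam 0 (t.cls 0 z) x‖ ^ 2 = 1 := by
    intro z
    have : (Finset.univ.filter fun z' => t.cls 0 z' = t.cls 0 z) = {z} := by
      ext z'; simp [t.cls_injective.eq_iff]
    simp [pruned, this]
  rw [sqFun, classes, Finset.sum_image (fun a _ b _ h => t.cls_injective h)]
  simp [h]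

lemma sum_pruned_succ (hm : m < t.n) (κ : K) :
    ∑ x, ‖t.pruned lam (m + 1) κ x‖ ^ 2 =
      ∑ x, ∑ κ' ∈ t.classes m with t.par m κ' = κ, ‖truncNorm lam (t.pruned lam m κ' x)‖ ^ 2 := by
  have h := sum_subgroup_translate (t.D m) fun x => ‖t.pruned lam (m + 1) κ x‖ ^ 2
  simp_rw [sum_D_pruned hm κ, ← Finset.mul_sum] at h
  have h0 : (Fintype.card (t.D m) : ℝ) ≠ 0 := by exact_mod_cast Fintype.card_ne_zero
  exact (mul_left_cancel₀ h0 h).symm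

lemma sum_sqFun_le (hm : m ≤ t.n) :
    ∑ x, t.sqFun lam m x ≤ Fintype.card G * Fintype.card ι := by
  induction m with
  | zero => simp [sqFun_zero]
  | succ m ih =>
    refine le_trans ?_ (ih (by omega))
    simp only [sqFun]
    rw [Finset.sum_comm]
    simp_rw [sum_pruned_succ (show m < t.n by omega)]
    rw [Finset.sum_comm]
    refine Finset.sum_le_sum fun x _ => ?_
    rw [sum_children]
    exact sum_truncNorm_le_sqFun x

lemma norm_pruned_succ_le (hl : 0 ≤ lam) (hm : m < t.n) (κ : K) (x : G) :
    ‖t.pruned lam (m + 1) κ x‖ ≤ t.b * lam := by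
  refine (norm_sum_le _ _).trans ((Finset.sum_le_card_nsmul _ _ lam
    fun κ' _ => norm_truncNorm_le' hl _).trans ?_)
  rw [nsmul_eq_mul]
  gcongr
  exact t.card_children m hm κ

lemma abs_high_le (hl : 0 ≤ lam) (hm : m < t.n) (κ : K) (x : G) :
    |t.high lam m κ x| ≤ (t.b * lam) ^ 2 := by
  have h1 : ‖t.pruned lam (m + 1) κ x‖ ^ 2 ≤ (t.b * lam) ^ 2 := by
    gcongr; exact norm_pruned_succ_le hl hm κ x
  have hb : ((t.b : ℝ)) ≤ (t.b : ℝ) ^ 2 := by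
    exact_mod_cast Nat.le_self_pow two_ne_zero _
  have h2 : ∑ κ' ∈ t.classes m with t.par m κ' = κ,
      ‖truncNorm lam (t.pruned lam m κ' x)‖ ^ 2 ≤ (t.b * lam) ^ 2 := by
    refine (Finset.sum_le_card_nsmul _ _ (lam ^ 2)
      fun κ' _ => by gcongr; exact norm_truncNorm_le' hl _).trans ?_
    rw [nsmul_eq_mul, mul_pow]
    gcongr
    exact le_trans (by exact_mod_cast t.card_children m hm κ) hb
  have h3 : 0 ≤ ∑ κ' ∈ t.classes m with t.par m κ' = κ,
      ‖truncNorm lam (t.pruned lam m κ' x)‖ ^ 2 := by positivity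
  have h4 := sq_nonneg ‖t.pruned lam (m + 1) κ x‖
  rw [abs_le, high]
  constructor <;> linarith

lemma sum_sq_sum_high_le (hl : 0 ≤ lam) (hm : m < t.n) :
    ∑ x, (∑ κ ∈ t.classes (m + 1), t.high lam m κ x) ^ 2 ≤
      2 * (t.b * lam) ^ 2 * (Fintype.card G * Fintype.card ι) := by
  have h1 : ∑ x, (∑ κ ∈ t.classes (m + 1), t.high lam m κ x) ^ 2 =
      ∑ κ ∈ t.classes (m + 1), ∑ x, t.high lam m κ x ^ 2 := by
    simp_rw [sq, Finset.sum_mul_sum]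
    rw [Finset.sum_comm]
    refine Finset.sum_congr rfl fun κ hκ => ?_
    rw [Finset.sum_comm, Finset.sum_eq_single_of_mem κ hκ]
    exact fun κ' hκ' hne => sum_high_mul_high hm hκ hκ' hne.symm
  have h2 : ∀ κ, ∑ x, t.high lam m κ x ^ 2 ≤
      (t.b * lam) ^ 2 * (2 * ∑ x, ‖t.pruned lam (m + 1) κ x‖ ^ 2) := by
    intro κ
    rw [two_mul]
    nth_rewrite 2 [sum_pruned_succ hm κ]
    rw [← Finset.sum_add_distrib, Finset.mul_sum]
    refine Finset.sum_le_sum fun x _ => ?_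
    rw [← sq_abs, sq]
    refine mul_le_mul (abs_high_le hl hm κ x) ?_ (abs_nonneg _) (by positivity)
    rw [high]
    refine (abs_sub _ _).trans (le_of_eq ?_)
    rw [abs_of_nonneg (by positivity), abs_of_nonneg (by positivity)]
  rw [h1]
  refine (Finset.sum_le_sum fun κ _ => h2 κ).trans ?_
  rw [← Finset.mul_sum, ← Finset.mul_sum, Finset.sum_comm]
  have := sum_sqFun_le (t := t) (lam := lam) (m := m + 1) hm
  simp only [sqFun] at this
  calc _ ≤ (t.b * lam) ^ 2 * (2 * ((Fintype.card G : ℝ) * Fintype.card ι)) := by gcongr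
    _ = _ := by ring

lemma chi_eq_of_mem_H {l : ℕ} (hm : 1 ≤ m) (hmn : m ≤ t.n) (hl : l ≤ m) {y : G}
    (hy : y ∈ t.H m) (κ : K) : t.Stab l κ y := by
  rintro z z' rfl hz'
  refine t.H_stab m hm hmn y hy z z' ?_
  clear hmn hm hy
  induction m, hl using Nat.le_induction with
  | base => exact hz'.symm
  | succ k _ ih => rw [← t.par_cls, ih, t.par_cls]

lemma sqFun_add {l : ℕ} (hm : 1 ≤ m) (hmn : m ≤ t.n) (hl : l ≤ m) {y : G} (hy : y ∈ t.H m)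
    (x : G) : t.sqFun lam l (x + y) = t.sqFun lam l x := by
  refine Finset.sum_congr rfl fun κ hκ => ?_
  rw [pruned_add' hκ (chi_eq_of_mem_H hm hmn hl hy κ)]

lemma part_zero (c : K) (x : G) : t.part lam 0 c x = ∑ z with t.cls t.n z = c, t.chi z x := by
  simp only [part, pruned]
  have h := Finset.sum_fiberwise_of_maps_to (s := Finset.univ.filter fun z => t.cls t.n z = c)
    (t := (t.classes 0).filter fun κ => t.anc κ = c) (g := t.cls 0)
    (fun z hz => by
      rw [Finset.mem_filter] at hz ⊢
      exact ⟨cls_mem_classes z, by rw [t.anc_cls 0 (Nat.zero_le _), hz.2]⟩)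
    fun z => t.chi z x
  rw [← h]
  refine Finset.sum_congr rfl fun κ hκ => Finset.sum_congr ?_ fun _ _ => rfl
  ext z
  rw [Finset.mem_filter] at hκ
  simp only [Finset.mem_filter, Finset.mem_univ, true_and]
  constructor
  · rintro rfl
    exact ⟨by rw [← hκ.2, t.anc_cls 0 (Nat.zero_le _)], rfl⟩
  · exact fun h => h.2

lemma anc_par (hm : m < t.n) {κ : K} (hκ : κ ∈ t.classes m) : t.anc (t.par m κ) = t.anc κ := by
  obtain ⟨z, rfl⟩ := mem_classes.1 hκ
  rw [t.par_cls, t.anc_cls _ hm, t.anc_cls _ hm.le]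

lemma part_succ (hm : m < t.n) (c : K) (x : G) :
    t.part lam (m + 1) c x =
      ∑ κ ∈ t.classes m with t.anc κ = c, truncNorm lam (t.pruned lam m κ x) := by
  simp only [part, pruned]
  rw [← Finset.sum_fiberwise_of_maps_to (s := (t.classes m).filter fun κ => t.anc κ = c)
    (t := (t.classes (m + 1)).filter fun κ => t.anc κ = c) (g := t.par m)
    (fun κ hκ => by
      rw [Finset.mem_filter] at hκ ⊢
      exact ⟨par_mem_classes hκ.1, by rw [anc_par hm hκ.1, hκ.2]⟩)]
  refine Finset.sum_congr rfl fun κ hκ => Finset.sum_congr ?_ fun _ _ => rfl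
  ext κ'
  rw [Finset.mem_filter] at hκ
  simp only [Finset.mem_filter]
  constructor
  · rintro ⟨h, rfl⟩
    exact ⟨⟨h, by rw [← anc_par hm h, hκ.2]⟩, rfl⟩
  · exact fun h => ⟨h.1.1, h.2⟩

lemma norm_part_succ_sub_le (hl : 0 < lam) (hm : m < t.n) (c : K) (x : G) :
    ‖t.part lam (m + 1) c x - t.part lam m c x‖ ≤ t.sqFun lam m x / lam := by
  rw [part_succ hm, part, ← Finset.sum_sub_distrib, sqFun, Finset.sum_div]
  refine (norm_sum_le _ _).trans ((Finset.sum_le_sum fun κ _ =>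
    norm_sub_truncNorm_le hl _).trans ?_)
  exact Finset.sum_le_sum_of_subset_of_nonneg (Finset.filter_subset _ _)
    fun _ _ _ => by positivity

lemma norm_part_sub_le {M : ℝ} (hl : 0 < lam) (hmn : m ≤ t.n) (c : K) (x : G) (hM : 0 ≤ M)
    (h : ∀ l < m, t.sqFun lam l x ≤ 2 ^ l * M) :
    ‖t.part lam m c x - t.part lam 0 c x‖ ≤ 2 ^ m * M / lam := by
  induction m with
  | zero => simp; positivity
  | succ m ih =>
    have h1 := ih (by omega) fun l hl => h l (by omega)
    have h2 := (norm_part_succ_sub_le (t := t) hl (show m < t.n by omega) c x).trans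
      (div_le_div_of_nonneg_right (h m (by omega)) hl.le)
    refine (norm_sub_le_norm_sub_add_norm_sub _ (t.part lam m c x) _).trans ?_
    refine (add_le_add h2 h1).trans (le_of_eq ?_)
    ring

lemma part_top (c : K) (hc : c ∈ t.classes t.n) (x : G) :
    t.part lam t.n c x = t.pruned lam t.n c x := by
  rw [part]
  have : (t.classes t.n).filter (fun κ => t.anc κ = c) = {c} := by
    ext κ
    simp only [Finset.mem_filter, Finset.mem_singleton]
    have h : ∀ κ ∈ t.classes t.n, t.anc κ = κ := by
      intro κ hκ
      obtain ⟨z, rfl⟩ := mem_classes.1 hκ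
      exact t.anc_cls _ le_rfl z
    constructor
    · rintro ⟨h1, h2⟩; rw [← h2, h κ h1]
    · rintro rfl; exact ⟨hc, h _ hc⟩
  rw [this, Finset.sum_singleton]

lemma sum_H_norm_part_mul_part (hm : 1 ≤ m) (hmn : m ≤ t.n) {c c' : K} (hne : c ≠ c') (x : G) :
    ∑ y : t.H m, ‖t.part lam m c (x + y)‖ ^ 2 * ‖t.part lam m c' (x + y)‖ ^ 2 =
      Fintype.card (t.H m) * ((∑ κ ∈ t.classes m with t.anc κ = c, ‖t.pruned lam m κ x‖ ^ 2) *
        ∑ κ ∈ t.classes m with t.anc κ = c', ‖t.pruned lam m κ x‖ ^ 2) := by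
  rcases isEmpty_or_nonempty ι with hι | hι
  · have : t.classes m = ∅ := by simp [classes]
    simp [part, this]
  set r : K → ι := Function.invFun (t.cls m)
  have hr : ∀ κ ∈ t.classes m, t.cls m (r κ) = κ := fun κ h =>
    Function.invFun_eq (mem_classes.1 h)
  have hadd : ∀ κ ∈ t.classes m, ∀ y ∈ t.H m, t.pruned lam m κ (x + y) =
      t.chi (r κ) y * t.pruned lam m κ x := by
    intro κ hκ y hy
    conv_lhs => rw [← hr κ hκ]
    rw [pruned_add m (chi_eq_of_mem_H hm hmn le_rfl hy _), hr κ hκ]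
  have hanc : ∀ κ ∈ t.classes m, t.cls t.n (r κ) = t.anc κ := by
    intro κ hκ
    rw [← t.anc_cls m hmn, hr κ hκ]
  have key := sum_subgroup_norm_sq (t.H m)
    ((t.classes m).filter (fun κ => t.anc κ = c) ×ˢ (t.classes m).filter fun κ => t.anc κ = c')
    (fun p => t.chi (r p.1) * t.chi (r p.2))
    (fun p => t.pruned lam m p.1 x * t.pruned lam m p.2 x) (by
      rintro ⟨κ₁, κ₁'⟩ h₁ ⟨κ₂, κ₂'⟩ h₂ hne'
      by_contra! hcon
      simp only [Finset.mem_product, Finset.mem_filter] at h₁ h₂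
      obtain ⟨⟨h1, h2⟩, h3, h4⟩ := h₁
      obtain ⟨⟨h5, h6⟩, h7, h8⟩ := h₂
      have := t.H_sep m hm hmn (r κ₁) (r κ₂) (r κ₁') (r κ₂')
        (by rw [hanc _ h1, hanc _ h5, h2, h6]) (by rw [hanc _ h3, hanc _ h7, h4, h8])
        (by rw [hanc _ h1, hanc _ h3, h2, h4]; exact hne) fun y hy => by
          simpa [AddChar.mul_apply] using hcon y hy
      rw [hr _ h1, hr _ h5, hr _ h3, hr _ h7] at this
      exact hne' (Prod.ext this.1 this.2))
  rw [Finset.sum_mul_sum, ← Finset.sum_product']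
  simp only [norm_mul, mul_pow] at key
  rw [← key]
  refine Finset.sum_congr rfl fun y _ => ?_
  rw [← mul_pow, ← norm_mul, part, part, Finset.sum_mul_sum, ← Finset.sum_product']
  congr 2
  refine Finset.sum_congr rfl fun p hp => ?_
  simp only [Finset.mem_product, Finset.mem_filter] at hp
  rw [hadd _ hp.1.1 y y.2, hadd _ hp.2.1 y y.2, AddChar.mul_apply]
  ring

/-- The sum of the products of the square norms of the parts over pairs of distinct top
classes. -/
noncomputable def bilin (t : CapTree G ι K) (lam : ℝ) (m : ℕ) (x : G) : ℝ :=
  ∑ p ∈ (t.classes t.n).offDiag, ‖t.part lam m p.1 x‖ ^ 2 * ‖t.part lam m p.2 x‖ ^ 2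

lemma sum_H_bilin_le (hm : 1 ≤ m) (hmn : m ≤ t.n) (x : G) :
    ∑ y : t.H m, t.bilin lam m (x + y) ≤ Fintype.card (t.H m) * t.sqFun lam m x ^ 2 := by
  simp only [bilin]
  rw [Finset.sum_comm]
  have h : ∑ c ∈ t.classes t.n, ∑ κ ∈ t.classes m with t.anc κ = c, ‖t.pruned lam m κ x‖ ^ 2 =
      t.sqFun lam m x := by
    refine Finset.sum_fiberwise_of_maps_to (fun κ hκ => ?_) _
    obtain ⟨z, rfl⟩ := mem_classes.1 hκ
    rw [t.anc_cls m hmn]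
    exact cls_mem_classes z
  rw [Finset.sum_congr rfl fun p hp =>
    sum_H_norm_part_mul_part hm hmn (Finset.mem_offDiag.1 hp).2.2 x, ← Finset.mul_sum, ← h, sq,
    Finset.sum_mul_sum, ← Finset.sum_product']
  gcongr
  intro p hp
  simp only [Finset.mem_offDiag, Finset.mem_product] at hp ⊢
  exact ⟨hp.1, hp.2.1⟩

/-- The points where the square functions first become large at level `m`. -/
noncomputable def exitSet (t : CapTree G ι K) (lam : ℝ) (m : ℕ) : Finset G :=
  Finset.univ.filter fun x => (∀ l < m, t.sqFun lam l x ≤ 2 ^ l * Fintype.card ι) ∧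
    2 ^ m * Fintype.card ι < t.sqFun lam m x

lemma mem_exitSet {x : G} : x ∈ t.exitSet lam m ↔
    (∀ l < m, t.sqFun lam l x ≤ 2 ^ l * Fintype.card ι) ∧
      2 ^ m * Fintype.card ι < t.sqFun lam m x := by
  simp [exitSet]

lemma sum_exitSet_bilin_le (hm : 1 ≤ m) (hmn : m ≤ t.n) :
    ∑ x ∈ t.exitSet lam m, t.bilin lam m x ≤ ∑ x ∈ t.exitSet lam m, t.sqFun lam m x ^ 2 := by
  have h := sum_subgroup_translate (t.H m) fun x =>
    if x ∈ t.exitSet lam m then t.bilin lam m x else 0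
  have hinv : ∀ x, ∀ y : t.H m, (x + (y : G) ∈ t.exitSet lam m) = (x ∈ t.exitSet lam m) := by
    intro x y
    rw [mem_exitSet, mem_exitSet, sqFun_add hm hmn le_rfl y.2]
    congr 1
    refine propext (forall₂_congr fun l hl => ?_)
    rw [sqFun_add hm hmn hl.le y.2]
  simp only [hinv] at h
  have h0 : (0 : ℝ) < Fintype.card (t.H m) := by exact_mod_cast Fintype.card_pos
  refine le_of_mul_le_mul_left ?_ h0
  rw [Finset.sum_ite_mem, Finset.univ_inter] at h
  rw [← h, Finset.mul_sum, ← Finset.sum_subset (Finset.subset_univ (t.exitSet lam m))]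
  · refine Finset.sum_le_sum fun x hx => ?_
    simp only [hx, if_true]
    exact sum_H_bilin_le hm hmn x
  · intro x _ hx
    simp [hx]

/-- The points where two of the sums over top classes are large. -/
noncomputable def levelSet (t : CapTree G ι K) (α : ℝ) : Finset G :=
  Finset.univ.filter fun x => ∃ c ∈ t.classes t.n, ∃ c' ∈ t.classes t.n, c ≠ c' ∧
    α ≤ ‖∑ z with t.cls t.n z = c, t.chi z x‖ ∧ α ≤ ‖∑ z with t.cls t.n z = c', t.chi z x‖

lemma sum_exitSet_sqFun_sq_le (hl : 0 ≤ lam) (hm : m < t.n) :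
    ∑ x ∈ t.exitSet lam (m + 1), t.sqFun lam (m + 1) x ^ 2 ≤
      8 * (t.b * lam) ^ 2 * (Fintype.card G * Fintype.card ι) := by
  have h : ∀ x ∈ t.exitSet lam (m + 1), t.sqFun lam (m + 1) x ^ 2 ≤
      4 * (∑ κ ∈ t.classes (m + 1), t.high lam m κ x) ^ 2 := by
    intro x hx
    rw [mem_exitSet] at hx
    have h1 := hx.1 m (Nat.lt_succ_self m)
    have h2 := hx.2
    have h3 := sqFun_succ_le (t := t) (lam := lam) (m := m) x
    have h4 : 0 ≤ t.sqFun lam (m + 1) x := Finset.sum_nonneg fun _ _ => by positivity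
    rw [pow_succ] at h2
    have h5 : t.sqFun lam (m + 1) x ≤ 2 * ∑ κ ∈ t.classes (m + 1), t.high lam m κ x := by
      linarith
    calc _ ≤ (2 * ∑ κ ∈ t.classes (m + 1), t.high lam m κ x) ^ 2 := by gcongr
      _ = _ := by ring
  refine (Finset.sum_le_sum h).trans ?_
  refine (Finset.sum_le_sum_of_subset_of_nonneg (Finset.subset_univ _)
    fun _ _ _ => by positivity).trans ?_
  rw [← Finset.mul_sum]
  have := sum_sq_sum_high_le hl hm
  linarith

lemma half_le_norm_part [Nonempty ι] {α : ℝ} (hα : 0 < α) (hmn : m ≤ t.n)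
    (hlam : lam = 2 ^ (t.n + 1) * Fintype.card ι / α) {c : K} {x : G}
    (h : ∀ l < m, t.sqFun lam l x ≤ 2 ^ l * Fintype.card ι)
    (hc : α ≤ ‖∑ z with t.cls t.n z = c, t.chi z x‖) : α / 2 ≤ ‖t.part lam m c x‖ := by
  have hM : (0 : ℝ) < Fintype.card ι := by exact_mod_cast Fintype.card_pos
  have hl : 0 < lam := by rw [hlam]; positivity
  have h1 := norm_part_sub_le hl hmn c x hM.le h
  have h2 : (2 : ℝ) ^ m * Fintype.card ι / lam ≤ α / 2 := by
    rw [div_le_iff₀ hl, hlam]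
    have : (2 : ℝ) ^ m ≤ 2 ^ t.n := pow_le_pow_right₀ one_le_two hmn
    calc (2 : ℝ) ^ m * Fintype.card ι ≤ 2 ^ t.n * Fintype.card ι := by gcongr
      _ = _ := by field_simp; ring
  rw [← part_zero (lam := lam)] at hc
  have h3 := norm_sub_norm_le (t.part lam 0 c x) (t.part lam m c x)
  rw [norm_sub_rev] at h3
  linarith

lemma card_levelSet_inter_exitSet_le [Nonempty ι] {α : ℝ} (hα : 0 < α) (hm : m < t.n)
    (hlam : lam = 2 ^ (t.n + 1) * Fintype.card ι / α) :
    (α / 2) ^ 6 * (t.levelSet α ∩ t.exitSet lam (m + 1)).card ≤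
      8 * t.b ^ 2 * 4 ^ t.n * (Fintype.card G * Fintype.card ι ^ 3) := by
  have hM : (0 : ℝ) < Fintype.card ι := by exact_mod_cast Fintype.card_pos
  have hl : 0 < lam := by rw [hlam]; positivity
  have hnn : ∀ x, 0 ≤ t.bilin lam (m + 1) x := fun x => Finset.sum_nonneg fun _ _ => by positivity
  have h1 : (α / 2) ^ 4 * (t.levelSet α ∩ t.exitSet lam (m + 1)).card ≤
      ∑ x ∈ t.exitSet lam (m + 1), t.bilin lam (m + 1) x := by
    refine le_trans ?_ (Finset.sum_le_sum_of_subset_of_nonneg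
      (Finset.inter_subset_right (s₁ := t.levelSet α)) fun x _ _ => hnn x)
    rw [mul_comm, ← nsmul_eq_mul]
    refine Finset.card_nsmul_le_sum _ _ _ fun x hx => ?_
    rw [Finset.mem_inter, mem_exitSet, levelSet, Finset.mem_filter] at hx
    obtain ⟨⟨-, c, hc, c', hc', hne, h1, h2⟩, hs, -⟩ := hx
    have h3 := half_le_norm_part hα hm hlam hs h1
    have h4 := half_le_norm_part hα hm hlam hs h2
    rw [bilin]
    refine le_trans ?_ (Finset.single_le_sum (f := fun p : K × K =>
      ‖t.part lam (m + 1) p.1 x‖ ^ 2 * ‖t.part lam (m + 1) p.2 x‖ ^ 2)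
      (fun _ _ => by positivity) (a := (c, c'))
      (Finset.mem_offDiag.2 ⟨hc, hc', hne⟩))
    calc (α / 2) ^ 4 = (α / 2) ^ 2 * (α / 2) ^ 2 := by ring
      _ ≤ _ := by gcongr
  have h2 := h1.trans
    ((sum_exitSet_bilin_le (by omega) hm).trans (sum_exitSet_sqFun_sq_le hl.le hm))
  calc _ = (α / 2) ^ 2 * ((α / 2) ^ 4 * (t.levelSet α ∩ t.exitSet lam (m + 1)).card) := by ring
    _ ≤ (α / 2) ^ 2 * (8 * (t.b * lam) ^ 2 * (Fintype.card G * Fintype.card ι)) := by gcongr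
    _ = _ := by
      have h4 : (4 : ℝ) ^ t.n = (2 ^ t.n) ^ 2 := by rw [← pow_mul, mul_comm, pow_mul]; norm_num
      rw [hlam, h4]
      field_simp
      ring

lemma card_levelSet_sdiff_le [Nonempty ι] {α : ℝ} (hα : 0 < α)
    (hlam : lam = 2 ^ (t.n + 1) * Fintype.card ι / α) :
    (α / 2) ^ 6 * (t.levelSet α \ (Finset.range t.n).biUnion
      fun m => t.exitSet lam (m + 1)).card ≤
      4 ^ t.n * (Fintype.card G * Fintype.card ι ^ 3) := by
  set V := t.levelSet α \ (Finset.range t.n).biUnion fun m => t.exitSet lam (m + 1)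
  have hV : ∀ x ∈ V, (α / 2) ^ 2 ≤ t.sqFun lam t.n x ∧
      t.sqFun lam t.n x ≤ 2 ^ t.n * Fintype.card ι := by
    intro x hx
    simp only [V, Finset.mem_sdiff, Finset.mem_biUnion, Finset.mem_range, not_exists, not_and,
      mem_exitSet, not_lt] at hx
    have h : ∀ l ≤ t.n, t.sqFun lam l x ≤ 2 ^ l * Fintype.card ι := by
      intro l
      induction l using Nat.strong_induction_on with
      | _ l ih =>
        intro hl
        rcases l with _ | l
        · simp [sqFun_zero]
        · exact hx.2 l hl fun k hk => ih k hk (hk.le.trans hl)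
    refine ⟨?_, h _ le_rfl⟩
    rw [levelSet, Finset.mem_filter] at hx
    obtain ⟨-, c, hc, -, -, -, h1, -⟩ := hx.1
    have h2 := half_le_norm_part hα le_rfl hlam (fun l hl => h l hl.le) h1
    rw [part_top c hc] at h2
    refine le_trans ?_ (Finset.single_le_sum (f := fun c => ‖t.pruned lam t.n c x‖ ^ 2)
      (fun _ _ => by positivity) hc)
    gcongr
  rcases V.eq_empty_or_nonempty with h0 | ⟨x, hx⟩
  · rw [h0]; simp; positivity
  have h1 : (α / 2) ^ 2 * V.card ≤ Fintype.card G * Fintype.card ι := by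
    refine le_trans ?_ (sum_sqFun_le (t := t) (lam := lam) le_rfl)
    refine le_trans ?_ (Finset.sum_le_sum_of_subset_of_nonneg (Finset.subset_univ V)
      fun x _ _ => Finset.sum_nonneg fun _ _ => by positivity)
    rw [mul_comm, ← nsmul_eq_mul]
    exact Finset.card_nsmul_le_sum _ _ _ fun x hx => (hV x hx).1
  have h2 := (hV x hx).1.trans (hV x hx).2
  calc _ = ((α / 2) ^ 2) ^ 2 * ((α / 2) ^ 2 * V.card) := by ring
    _ ≤ (2 ^ t.n * Fintype.card ι) ^ 2 * (Fintype.card G * Fintype.card ι) := by gcongr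
    _ = _ := by
      have h4 : (4 : ℝ) ^ t.n = (2 ^ t.n) ^ 2 := by rw [← pow_mul, mul_comm, pow_mul]; norm_num
      rw [h4]
      ring

lemma one_le_b [Nonempty ι] : 1 ≤ t.b :=
  le_trans (Finset.card_pos.2 (Finset.univ_nonempty.image _)) t.card_top

lemma card_levelSet_le [Nonempty ι] {α : ℝ} (hα : 0 < α) :
    α ^ 6 * (t.levelSet α).card ≤
      512 * t.b ^ 2 * 8 ^ t.n * (Fintype.card G * Fintype.card ι ^ 3) := by
  obtain ⟨lam, hlam⟩ : ∃ lam, lam = 2 ^ (t.n + 1) * Fintype.card ι / α := ⟨_, rfl⟩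
  have h1 : ((t.levelSet α).card : ℝ) ≤
      (t.levelSet α \ (Finset.range t.n).biUnion fun m => t.exitSet lam (m + 1)).card +
        ∑ m ∈ Finset.range t.n, ((t.levelSet α ∩ t.exitSet lam (m + 1)).card : ℝ) := by
    rw [← Finset.card_sdiff_add_card_inter (t.levelSet α)
      ((Finset.range t.n).biUnion fun m => t.exitSet lam (m + 1)), Finset.inter_biUnion]
    push_cast
    gcongr
    exact_mod_cast Finset.card_biUnion_le
  have hb : (1 : ℝ) ≤ t.b ^ 2 := by exact_mod_cast Nat.one_le_pow _ _ one_le_b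
  have hn : (t.n : ℝ) + 1 ≤ 2 ^ t.n := by exact_mod_cast Nat.lt_two_pow_self
  have h8 : (8 : ℝ) ^ t.n = 2 ^ t.n * 4 ^ t.n := by rw [← mul_pow]; norm_num
  set X : ℝ := Fintype.card G * Fintype.card ι ^ 3
  have hX : 0 ≤ X := by positivity
  have h2 : (α / 2) ^ 6 * (t.levelSet α).card ≤
      4 ^ t.n * X + t.n * (8 * t.b ^ 2 * 4 ^ t.n * X) := by
    refine (mul_le_mul_of_nonneg_left h1 (by positivity)).trans ?_
    rw [mul_add, Finset.mul_sum]
    refine add_le_add (card_levelSet_sdiff_le hα hlam) ?_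
    refine (Finset.sum_le_card_nsmul _ _ _ fun m hm =>
      card_levelSet_inter_exitSet_le hα (Finset.mem_range.1 hm) hlam).trans ?_
    rw [Finset.card_range, nsmul_eq_mul]
  have h3 : 4 ^ t.n * X + t.n * (8 * t.b ^ 2 * 4 ^ t.n * X) ≤ 8 * t.b ^ 2 * 8 ^ t.n * X := by
    calc _ = (1 + 8 * t.n * t.b ^ 2) * (4 ^ t.n * X) := by ring
      _ ≤ (8 * t.b ^ 2 * (t.n + 1)) * (4 ^ t.n * X) := by gcongr; nlinarith
      _ ≤ (8 * t.b ^ 2 * 2 ^ t.n) * (4 ^ t.n * X) := by gcongr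
      _ = _ := by rw [h8]; ring
  calc _ = 64 * ((α / 2) ^ 6 * (t.levelSet α).card) := by ring
    _ ≤ 64 * (8 * t.b ^ 2 * 8 ^ t.n * X) := mul_le_mul_of_nonneg_left (h2.trans h3) (by norm_num)
    _ = _ := by ring

lemma exists_pair_of_narrow [Nonempty ι] (x : G) :
    (‖∑ z, t.chi z x‖ ^ 6 ≤
      64 * ∑ c ∈ t.classes t.n, ‖∑ z with t.cls t.n z = c, t.chi z x‖ ^ 6) ∨
    x ∈ t.levelSet (‖∑ z, t.chi z x‖ / (2 * t.b)) := by
  set F : K → ℝ := fun c => ‖∑ z with t.cls t.n z = c, t.chi z x‖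
  set S := ‖∑ z, t.chi z x‖
  have hb : (1 : ℝ) ≤ t.b := by exact_mod_cast one_le_b
  have hS : S ≤ ∑ c ∈ t.classes t.n, F c := by
    simp only [S, F]
    rw [← Finset.sum_fiberwise_of_maps_to (s := Finset.univ) (t := t.classes t.n)
      (fun z _ => cls_mem_classes z)]
    exact norm_sum_le _ _
  have hS0 : 0 ≤ S := norm_nonneg _
  have hcard : ((t.classes t.n).card : ℝ) ≤ t.b := by exact_mod_cast t.card_top
  obtain ⟨c, hc, hcS⟩ : ∃ c ∈ t.classes t.n, S / (2 * t.b) ≤ F c := by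
    by_contra! h
    have h1 : (t.classes t.n).Nonempty := Finset.univ_nonempty.image _
    have h2 := Finset.sum_lt_sum_of_nonempty h1 h
    rw [Finset.sum_const, nsmul_eq_mul] at h2
    have h3 : (t.classes t.n).card * (S / (2 * t.b)) ≤ t.b * (S / (2 * t.b)) := by gcongr
    have h4 : t.b * (S / (2 * t.b)) = S / 2 := by field_simp
    linarith
  by_cases h : ∃ c' ∈ t.classes t.n, c ≠ c' ∧ S / (2 * t.b) ≤ F c'
  · right
    obtain ⟨c', hc', hne, h'⟩ := h
    rw [levelSet, Finset.mem_filter]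
    exact ⟨Finset.mem_univ _, c, hc, c', hc', hne, hcS, h'⟩
  · left
    push Not at h
    have h1 : S / 2 ≤ F c := by
      rw [← Finset.add_sum_erase _ _ hc] at hS
      have h2 : ∑ c' ∈ (t.classes t.n).erase c, F c' ≤ t.b * (S / (2 * t.b)) := by
        refine (Finset.sum_le_card_nsmul _ _ (S / (2 * t.b)) fun c' hc' => ?_).trans ?_
        · rw [Finset.mem_erase] at hc'
          exact (h c' hc'.2 hc'.1.symm).le
        · rw [nsmul_eq_mul]
          gcongr
          refine le_trans ?_ t.card_top
          exact Finset.card_le_card (Finset.erase_subset _ _)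
      have h4 : t.b * (S / (2 * t.b)) = S / 2 := by field_simp
      linarith
    have h2 := Finset.single_le_sum (f := fun c => F c ^ 6) (fun _ _ => by positivity) hc
    calc S ^ 6 = 64 * (S / 2) ^ 6 := by ring
      _ ≤ 64 * F c ^ 6 := by gcongr
      _ ≤ _ := by gcongr

lemma levelSet_anti {α β : ℝ} (h : α ≤ β) : t.levelSet β ⊆ t.levelSet α := by
  intro x hx
  rw [levelSet, Finset.mem_filter] at hx ⊢
  obtain ⟨h0, c, hc, c', hc', hne, h1, h2⟩ := hx
  exact ⟨h0, c, hc, c', hc', hne, h.trans h1, h.trans h2⟩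

lemma norm_pow_six_le [Nonempty ι] (x : G) :
    ‖∑ z, t.chi z x‖ ^ 6 ≤ 1 +
      64 * ∑ c ∈ t.classes t.n, ‖∑ z with t.cls t.n z = c, t.chi z x‖ ^ 6 +
      ∑ i ∈ Finset.range (Nat.log 2 (Fintype.card ι) + 1),
        if x ∈ t.levelSet (2 ^ i / (2 * t.b)) then (2 ^ (i + 1) : ℝ) ^ 6 else 0 := by
  have hnn : 0 ≤ ∑ i ∈ Finset.range (Nat.log 2 (Fintype.card ι) + 1),
      if x ∈ t.levelSet (2 ^ i / (2 * t.b)) then (2 ^ (i + 1) : ℝ) ^ 6 else 0 :=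
    Finset.sum_nonneg fun _ _ => by split_ifs <;> positivity
  have hnn' : 0 ≤ ∑ c ∈ t.classes t.n, ‖∑ z with t.cls t.n z = c, t.chi z x‖ ^ 6 := by positivity
  rcases exists_pair_of_narrow (t := t) x with h | h
  · linarith
  set S := ‖∑ z, t.chi z x‖
  have hS0 : 0 ≤ S := norm_nonneg _
  rcases lt_or_ge S 1 with hS | hS
  · have : S ^ 6 ≤ 1 := pow_le_one₀ hS0 hS.le
    linarith
  have hfl : ⌊S⌋₊ ≠ 0 := by
    have := Nat.floor_pos.2 hS
    omega
  have hSM : S ≤ Fintype.card ι := by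
    refine (norm_sum_le _ _).trans ?_
    simp
  set i := Nat.log 2 ⌊S⌋₊
  have h1 : (2 : ℝ) ^ i ≤ S := by
    refine le_trans ?_ (Nat.floor_le hS0)
    exact_mod_cast Nat.pow_log_le_self 2 hfl
  have h2 : S < 2 ^ (i + 1) := by
    refine (Nat.lt_floor_add_one S).trans_le ?_
    exact_mod_cast Nat.lt_pow_succ_log_self one_lt_two _
  have hi : i ∈ Finset.range (Nat.log 2 (Fintype.card ι) + 1) := by
    rw [Finset.mem_range, Nat.lt_succ_iff]
    exact Nat.log_mono_right (Nat.floor_le_of_le hSM)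
  have hx : x ∈ t.levelSet (2 ^ i / (2 * t.b)) := levelSet_anti (by gcongr) h
  have h3 := Finset.single_le_sum (f := fun i =>
    if x ∈ t.levelSet (2 ^ i / (2 * t.b)) then (2 ^ (i + 1) : ℝ) ^ 6 else 0)
    (fun _ _ => by split_ifs <;> positivity) hi
  simp only [hx, if_true] at h3
  have h4 : S ^ 6 ≤ (2 ^ (i + 1)) ^ 6 := by gcongr
  linarith

theorem sum_norm_pow_six_le [Nonempty ι] :
    ∑ x, ‖∑ z, t.chi z x‖ ^ 6 ≤
      64 * ∑ c ∈ t.classes t.n, ∑ x, ‖∑ z with t.cls t.n z = c, t.chi z x‖ ^ 6 +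
      2 ^ 22 * (Nat.log 2 (Fintype.card ι) + 1) * t.b ^ 8 * 8 ^ t.n *
        (Fintype.card G * Fintype.card ι ^ 3) := by
  have hb : (1 : ℝ) ≤ t.b := by exact_mod_cast one_le_b
  have hM : (1 : ℝ) ≤ Fintype.card ι := by exact_mod_cast Fintype.card_pos
  set X : ℝ := Fintype.card G * Fintype.card ι ^ 3
  have hG : (Fintype.card G : ℝ) ≤ X := le_mul_of_one_le_right (by positivity)
    (one_le_pow₀ hM)
  have hX : 0 ≤ X := by positivity
  have h8 : (1 : ℝ) ≤ 8 ^ t.n := one_le_pow₀ (by norm_num)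
  refine (Finset.sum_le_sum fun x _ => norm_pow_six_le x).trans ?_
  rw [Finset.sum_add_distrib, Finset.sum_add_distrib, ← Finset.mul_sum, Finset.sum_comm,
    Finset.sum_comm (s := Finset.univ) (t := Finset.range _)]
  simp_rw [Finset.sum_ite_mem, Finset.univ_inter]
  have h1 : ∀ i ∈ Finset.range (Nat.log 2 (Fintype.card ι) + 1),
      ∑ _x ∈ t.levelSet (2 ^ i / (2 * t.b)), ((2 : ℝ) ^ (i + 1)) ^ 6 ≤
        2 ^ 21 * t.b ^ 8 * 8 ^ t.n * X := by
    intro i _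
    have h2 := card_levelSet_le (t := t) (α := 2 ^ i / (2 * t.b)) (by positivity)
    rw [Finset.sum_const, nsmul_eq_mul]
    calc _ = (4 * t.b) ^ 6 * ((2 ^ i / (2 * t.b)) ^ 6 *
          (t.levelSet (2 ^ i / (2 * t.b))).card : ℝ) := by field_simp; ring
      _ ≤ (4 * t.b) ^ 6 * (512 * t.b ^ 2 * 8 ^ t.n * X) := by gcongr
      _ = _ := by ring
  have h2 := Finset.sum_le_card_nsmul _ _ _ h1
  rw [Finset.card_range, nsmul_eq_mul] at h2
  push_cast at h2
  have h3 : X ≤ 2 ^ 21 * (Nat.log 2 (Fintype.card ι) + 1) * t.b ^ 8 * 8 ^ t.n * X := by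
    refine le_mul_of_one_le_left hX ?_
    refine one_le_mul_of_one_le_of_one_le (one_le_mul_of_one_le_of_one_le
      (one_le_mul_of_one_le_of_one_le (by norm_num) ?_) (one_le_pow₀ hb)) h8
    have : (0 : ℝ) ≤ Nat.log 2 (Fintype.card ι) := by positivity
    linarith
  have h4 : ∑ _x : G, (1 : ℝ) ≤ X := by simpa using hG
  linarith

end CapTree

end CapTree

section CircleArithmetic

/-- Divisibility of both coordinates of an integer vector. -/
def VecDvd (d : ℤ) (v : ℤ × ℤ) : Prop := d ∣ v.1 ∧ d ∣ v.2

/-- The standard inner product of integer vectors. -/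
def vecDot (u v : ℤ × ℤ) : ℤ := u.1 * v.1 + u.2 * v.2

/-- The determinant of two integer vectors. -/
def vecDet (u v : ℤ × ℤ) : ℤ := u.1 * v.2 - u.2 * v.1

variable {q R : ℤ}

lemma VecDvd.sub {d : ℤ} {u v : ℤ × ℤ} (hu : VecDvd d u) (hv : VecDvd d v) : VecDvd d (u - v) :=
  ⟨dvd_sub hu.1 hv.1, dvd_sub hu.2 hv.2⟩

lemma VecDvd.add {d : ℤ} {u v : ℤ × ℤ} (hu : VecDvd d u) (hv : VecDvd d v) : VecDvd d (u + v) :=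
  ⟨dvd_add hu.1 hv.1, dvd_add hu.2 hv.2⟩

lemma VecDvd.of_dvd {d e : ℤ} {v : ℤ × ℤ} (h : VecDvd d v) (hde : e ∣ d) : VecDvd e v :=
  ⟨hde.trans h.1, hde.trans h.2⟩

lemma VecDvd.dvd_vecDot {d e : ℤ} {u v : ℤ × ℤ} (hu : VecDvd d u) (hv : VecDvd e v) :
    d * e ∣ vecDot u v :=
  dvd_add (mul_dvd_mul hu.1 hv.1) (mul_dvd_mul hu.2 hv.2)

lemma VecDvd.dvd_vecDot_left {d : ℤ} {u : ℤ × ℤ} (hu : VecDvd d u) (v : ℤ × ℤ) :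
    d ∣ vecDot u v :=
  dvd_add (Dvd.dvd.mul_right hu.1 _) (Dvd.dvd.mul_right hu.2 _)

lemma pow_dvd_of_dvd_mul_left_of_prime (hq : Prime q) {k : ℕ} {a b : ℤ} (ha : ¬ q ∣ a)
    (h : q ^ k ∣ a * b) : q ^ k ∣ b :=
  IsCoprime.dvd_of_dvd_mul_left
    (((hq.irreducible.coprime_iff_not_dvd).2 ha).pow_left) h

/-- If `z, z'` are points of a circle congruent modulo `d`, the chord `z - z'` is
orthogonal to `z` modulo `d ^ 2`. -/
lemma pow_dvd_vecDot_chord (hq : Prime q) (h2 : ¬ q ∣ 2) {k : ℕ} {z w : ℤ × ℤ}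
    (hz : z.1 ^ 2 + z.2 ^ 2 = R) (hw : w.1 ^ 2 + w.2 ^ 2 = R) (h : VecDvd (q ^ k) (z - w)) :
    q ^ (2 * k) ∣ vecDot (z - w) w := by
  have h1 : 2 * vecDot (z - w) w = -vecDot (z - w) (z - w) := by
    simp only [vecDot, Prod.fst_sub, Prod.snd_sub]
    linear_combination hz - hw
  refine pow_dvd_of_dvd_mul_left_of_prime hq h2 ?_
  rw [h1, dvd_neg, two_mul, pow_add]
  exact h.dvd_vecDot h

lemma not_pow_dvd_vecDet (hq : Prime q) (h2 : ¬ q ∣ 2) (hR : ¬ q ∣ R) {k : ℕ} {w w' : ℤ × ℤ}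
    (hw : w.1 ^ 2 + w.2 ^ 2 = R) (hw' : w'.1 ^ 2 + w'.2 ^ 2 = R) (h1 : VecDvd q (w' - w))
    (hk : ¬ VecDvd (q ^ k) (w' - w)) : ¬ q ^ k ∣ vecDet w w' := by
  intro hdet
  apply hk
  set h := w' - w
  have hdet' : q ^ k ∣ vecDet w h := by
    have : vecDet w h = vecDet w w' := by simp [vecDet, h]; ring
    rwa [this]
  have hdot : 2 * vecDot h w = -vecDot h h := by
    simp only [vecDot, h, Prod.fst_sub, Prod.snd_sub]
    linear_combination hw' - hw
  have hid : (vecDot h w + 2 * R) * vecDot h w = -vecDet w h ^ 2 := by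
    have : vecDot h w ^ 2 + vecDet w h ^ 2 = R * vecDot h h := by
      rw [← hw]; simp only [vecDot, vecDet]; ring
    linear_combination this + R * hdot
  have hdot' : q ^ k ∣ vecDot h w := by
    refine pow_dvd_of_dvd_mul_left_of_prime hq (a := vecDot h w + 2 * R) ?_ ?_
    · intro hcon
      rw [dvd_add_right (h1.dvd_vecDot_left w)] at hcon
      exact (hq.dvd_or_dvd hcon).elim h2 hR
    · rw [hid, dvd_neg, sq]
      exact hdet'.mul_right _
  have e1 : R * h.1 = vecDot h w * w.1 - vecDet w h * w.2 := by
    rw [← hw]; simp only [vecDot, vecDet]; ring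
  have e2 : R * h.2 = vecDot h w * w.2 + vecDet w h * w.1 := by
    rw [← hw]; simp only [vecDot, vecDet]; ring
  exact ⟨pow_dvd_of_dvd_mul_left_of_prime hq hR
      (e1 ▸ dvd_sub (hdot'.mul_right _) (hdet'.mul_right _)),
    pow_dvd_of_dvd_mul_left_of_prime hq hR
      (e2 ▸ dvd_add (hdot'.mul_right _) (hdet'.mul_right _))⟩

/-- A vector divisible by `q ^ (s + k)` splits along two transversal directions of the circle. -/
lemma exists_add_eq_of_not_dvd_vecDet (hq : Prime q) {k s : ℕ} {w w' v : ℤ × ℤ}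
    (hdet : ¬ q ^ (k + 1) ∣ vecDet w w') (hv : VecDvd (q ^ (s + k)) v) :
    ∃ (c c' : ℤ) (a : ℤ × ℤ), v = (q ^ s * c) • w + q ^ (s + k + 1) • a + (q ^ s * c') • w' := by
  obtain ⟨e, f, hef⟩ : ∃ e f, q ^ k = vecDet w w' * e + q ^ (k + 1) * f := by
    obtain ⟨i, hi, hass⟩ := (dvd_prime_pow hq (k + 1)).1
      (gcd_dvd_right (vecDet w w') (q ^ (k + 1)))
    have hik : i ≤ k := by
      by_contra! hcon
      apply hdet
      obtain rfl : i = k + 1 := by omega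
      exact hass.symm.dvd.trans (gcd_dvd_left _ _)
    have h1 : gcd (vecDet w w') (q ^ (k + 1)) ∣ q ^ k := hass.dvd.trans (pow_dvd_pow q hik)
    exact (gcd_dvd_iff_exists _ _).1 h1
  obtain ⟨⟨a₁, h₁⟩, a₂, h₂⟩ := hv
  refine ⟨e * vecDet (a₁, a₂) w', e * vecDet w (a₁, a₂), f • (a₁, a₂), ?_⟩
  have hp : q ^ (s + k + 1) = q ^ s * q ^ (k + 1) := by ring
  rw [pow_add, hef] at h₁ h₂
  ext
  · simp only [Prod.fst_add, Prod.smul_fst, smul_eq_mul, h₁, hp, vecDet]; ring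
  · simp only [Prod.snd_add, Prod.smul_snd, smul_eq_mul, h₂, hp, vecDet]; ring

lemma vecDvd_chords_of_bilinear (hq : Prime q) (h2 : ¬ q ∣ 2) (hR : ¬ q ∣ R) {j k : ℕ}
    (hj : 1 ≤ j) {z₁ z₂ w₁ w₂ w₀ : ℤ × ℤ}
    (hz₁ : z₁.1 ^ 2 + z₁.2 ^ 2 = R) (hz₂ : z₂.1 ^ 2 + z₂.2 ^ 2 = R)
    (hw₁ : w₁.1 ^ 2 + w₁.2 ^ 2 = R) (hw₂ : w₂.1 ^ 2 + w₂.2 ^ 2 = R)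
    (hz₀ : VecDvd (q ^ j) (z₁ - w₀)) (hw₀ : VecDvd (q ^ j) (w₁ - w₀))
    (hz : VecDvd (q ^ (j + 1)) (z₁ - z₂)) (hw : VecDvd (q ^ (j + 1)) (w₁ - w₂))
    (hne : ¬ VecDvd (q ^ (j + 1)) (z₁ - w₁))
    (hξ : VecDvd (q ^ k) (z₁ + w₁ - (z₂ + w₂)))
    (hξ₀ : q ^ (k + j) ∣ vecDot (z₁ + w₁ - (z₂ + w₂)) w₀) :
    VecDvd (q ^ k) (z₁ - z₂) ∧ VecDvd (q ^ k) (w₁ - w₂) := by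
  have hjj : q ^ j ∣ q ^ (j + 1) := pow_dvd_pow q (Nat.le_succ j)
  have hq0 : q ^ j ≠ 0 := pow_ne_zero _ hq.ne_zero
  have hz₂₀ : VecDvd (q ^ j) (z₂ - w₀) := by
    have := hz₀.sub (hz.of_dvd hjj)
    simpa using this
  have hw₂₀ : VecDvd (q ^ j) (w₂ - w₀) := by
    have := hw₀.sub (hw.of_dvd hjj)
    simpa using this
  set p := z₁ + z₂ with hp
  set p' := w₁ + w₂ with hp'
  set h' := w₁ - w₂ with hh'
  have hph : q ^ (k + j) ∣ vecDot p h' := by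
    have e : vecDot p h' = 2 * vecDot (z₁ + w₁ - (z₂ + w₂)) w₀ +
        vecDot (z₁ + w₁ - (z₂ + w₂)) ((z₁ - w₀) + (z₂ - w₀)) := by
      simp only [hp, hh', vecDot, Prod.fst_sub, Prod.snd_sub, Prod.fst_add, Prod.snd_add]
      linear_combination hz₂ - hz₁
    rw [e]
    refine dvd_add (hξ₀.mul_left _) ?_
    rw [pow_add]
    exact hξ.dvd_vecDot (hz₀.add hz₂₀)
  have hpp : VecDvd (q ^ j) (p' - p) := by
    have := (hw₀.add hw₂₀).sub (hz₀.add hz₂₀)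
    convert this using 1
    simp only [hp, hp']; abel
  obtain ⟨δ, hδ⟩ : ∃ δ : ℤ × ℤ, p' - p = q ^ j • δ := by
    obtain ⟨⟨a, ha⟩, b, hb⟩ := hpp
    exact ⟨(a, b), Prod.ext (by simpa using ha) (by simpa using hb)⟩
  have hδ1 : w₁.1 + w₂.1 - (z₁.1 + z₂.1) = q ^ j * δ.1 := by
    simpa [hp, hp'] using congrArg Prod.fst hδ
  have hδ2 : w₁.2 + w₂.2 - (z₁.2 + z₂.2) = q ^ j * δ.2 := by
    simpa [hp, hp'] using congrArg Prod.snd hδ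
  have hδh : q ^ k ∣ vecDot δ h' := by
    have e : q ^ j * vecDot δ h' = -vecDot p h' := by
      simp only [vecDot, hp, hh', Prod.fst_sub, Prod.snd_sub, Prod.fst_add, Prod.snd_add]
      linear_combination hw₁ - hw₂ - (w₁.1 - w₂.1) * hδ1 - (w₁.2 - w₂.2) * hδ2
    refine (mul_dvd_mul_iff_left hq0).1 ?_
    rw [e, dvd_neg, mul_comm, ← pow_add]
    exact hph
  have hpδ : q ∣ vecDot p δ := by
    have e : q ^ j * (2 * vecDot p δ + q ^ j * vecDot δ δ) =
        vecDot (z₁ - z₂) (z₁ - z₂) - vecDot h' h' := by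
      simp only [vecDot, hp, hh', Prod.fst_sub, Prod.snd_sub, Prod.fst_add, Prod.snd_add]
      linear_combination 2 * (hw₁ + hw₂ - hz₁ - hz₂)
        - (q ^ j * δ.1 + w₁.1 + w₂.1 + (z₁.1 + z₂.1)) * hδ1
        - (q ^ j * δ.2 + w₁.2 + w₂.2 + (z₁.2 + z₂.2)) * hδ2
    have hd : q ^ j * q ∣ q ^ j * (2 * vecDot p δ + q ^ j * vecDot δ δ) := by
      rw [e, ← pow_succ]
      exact dvd_sub (hz.dvd_vecDot_left _) (hw.dvd_vecDot_left _)
    have hd' := (mul_dvd_mul_iff_left hq0).1 hd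
    rw [dvd_add_left (Dvd.dvd.mul_right (dvd_pow_self q (by omega)) _)] at hd'
    exact (hq.dvd_or_dvd hd').resolve_left h2
  have hδ0 : ¬ VecDvd q δ := by
    rintro ⟨⟨a, ha⟩, b, hb⟩
    apply hne
    have h1 : q ^ (j + 1) ∣ 2 * (z₁.1 - w₁.1) := by
      have e : 2 * (z₁.1 - w₁.1) = (z₁ - z₂).1 - (w₁ - w₂).1 - q ^ (j + 1) * a := by
        simp only [Prod.fst_sub]
        rw [ha] at hδ1
        linear_combination -hδ1
      rw [e]
      exact dvd_sub (dvd_sub hz.1 hw.1) (dvd_mul_right _ _)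
    have h3 : q ^ (j + 1) ∣ 2 * (z₁.2 - w₁.2) := by
      have e : 2 * (z₁.2 - w₁.2) = (z₁ - z₂).2 - (w₁ - w₂).2 - q ^ (j + 1) * b := by
        simp only [Prod.snd_sub]
        rw [hb] at hδ2
        linear_combination -hδ2
      rw [e]
      exact dvd_sub (dvd_sub hz.2 hw.2) (dvd_mul_right _ _)
    exact ⟨pow_dvd_of_dvd_mul_left_of_prime hq h2 h1, pow_dvd_of_dvd_mul_left_of_prime hq h2 h3⟩
  have hqz : VecDvd q (z₁ - z₂) := hz.of_dvd (dvd_pow_self q (Nat.succ_ne_zero j))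
  have hpp0 : ¬ q ∣ vecDot p p := by
    intro hcon
    have e : vecDot p p = 2 * 2 * R - vecDot (z₁ - z₂) (z₁ - z₂) := by
      simp only [vecDot, hp, Prod.fst_sub, Prod.snd_sub, Prod.fst_add, Prod.snd_add]
      linear_combination 2 * hz₁ + 2 * hz₂
    rw [e, dvd_sub_left (hqz.dvd_vecDot_left _)] at hcon
    exact (hq.dvd_or_dvd hcon).elim (fun h => (hq.dvd_or_dvd h).elim h2 h2) hR
  have hdet : ¬ q ∣ vecDet p δ := by
    intro hcon
    apply hδ0
    have e1 : vecDot p p * δ.1 = vecDot p δ * p.1 - vecDet p δ * p.2 := by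
      simp only [vecDot, vecDet]; ring
    have e2 : vecDot p p * δ.2 = vecDot p δ * p.2 + vecDet p δ * p.1 := by
      simp only [vecDot, vecDet]; ring
    exact ⟨(hq.dvd_or_dvd (e1 ▸ dvd_sub (hpδ.mul_right _) (hcon.mul_right _))).resolve_left hpp0,
      (hq.dvd_or_dvd (e2 ▸ dvd_add (hpδ.mul_right _) (hcon.mul_right _))).resolve_left hpp0⟩
  have hph' : q ^ k ∣ vecDot p h' := (pow_dvd_pow q (Nat.le_add_right k j)).trans hph
  have hh : VecDvd (q ^ k) h' := by
    have e1 : vecDet p δ * h'.1 = vecDot p h' * δ.2 - vecDot δ h' * p.2 := by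
      simp only [vecDot, vecDet]; ring
    have e2 : vecDet p δ * h'.2 = vecDot δ h' * p.1 - vecDot p h' * δ.1 := by
      simp only [vecDot, vecDet]; ring
    exact ⟨pow_dvd_of_dvd_mul_left_of_prime hq hdet
        (e1 ▸ dvd_sub (hph'.mul_right _) (hδh.mul_right _)),
      pow_dvd_of_dvd_mul_left_of_prime hq hdet
        (e2 ▸ dvd_sub (hδh.mul_right _) (hph'.mul_right _))⟩
  refine ⟨?_, hh⟩
  have := hξ.sub hh
  convert this using 1
  simp only [hh']; abel

end CircleArithmetic

section CircleCharacters

/-- Reduction of integer vectors. -/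
def vecCast (Q : ℕ) : ℤ × ℤ →+ ZMod Q × ZMod Q :=
  (Int.castAddHom (ZMod Q)).prodMap (Int.castAddHom (ZMod Q))

/-- The character of `(ZMod Q) ^ 2` with frequency `z`. -/
noncomputable def vecChar (Q : ℕ) [NeZero Q] (z : ℤ × ℤ) : AddChar (ZMod Q × ZMod Q) ℂ :=
  ZMod.stdAddChar.compAddMonoidHom
    ((AddMonoidHom.mulLeft (z.1 : ZMod Q)).coprod (AddMonoidHom.mulLeft (z.2 : ZMod Q)))

variable {Q : ℕ} [NeZero Q]

lemma vecChar_apply (z : ℤ × ℤ) (y : ZMod Q × ZMod Q) :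
    vecChar Q z y = ZMod.stdAddChar ((z.1 : ZMod Q) * y.1 + (z.2 : ZMod Q) * y.2) := rfl

lemma vecChar_add (z w : ℤ × ℤ) (y : ZMod Q × ZMod Q) :
    vecChar Q (z + w) y = vecChar Q z y * vecChar Q w y := by
  rw [vecChar_apply, vecChar_apply, vecChar_apply, ← AddChar.map_add_eq_mul]
  congr 1
  simp only [Prod.fst_add, Prod.snd_add]
  push_cast
  ring

lemma vecChar_vecCast_eq_iff {z z' v : ℤ × ℤ} :
    vecChar Q z (vecCast Q v) = vecChar Q z' (vecCast Q v) ↔ (Q : ℤ) ∣ vecDot (z - z') v := by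
  rw [vecChar_apply, vecChar_apply, ZMod.injective_stdAddChar.eq_iff,
    ← ZMod.intCast_zmod_eq_zero_iff_dvd, ← sub_eq_zero]
  simp only [vecCast, vecDot, AddMonoidHom.coe_prodMap, Prod.map, Int.coe_castAddHom]
  push_cast [Prod.fst_sub, Prod.snd_sub]
  constructor <;> intro h <;> rw [← h] <;> ring

/-- Integer vectors divisible by `d`. -/
def vecMultiples (d : ℤ) : AddSubgroup (ℤ × ℤ) where
  carrier := {v | VecDvd d v}
  zero_mem' := ⟨dvd_zero _, dvd_zero _⟩
  add_mem' := VecDvd.add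
  neg_mem' h := ⟨h.1.neg_right, h.2.neg_right⟩

/-- Coordinatewise remainders. -/
def vecMod (d : ℤ) (v : ℤ × ℤ) : ℤ × ℤ := (v.1 % d, v.2 % d)

lemma vecMod_eq_iff {d : ℤ} {v w : ℤ × ℤ} : vecMod d v = vecMod d w ↔ VecDvd d (v - w) := by
  simp only [vecMod, VecDvd, Prod.ext_iff, Int.emod_eq_emod_iff_emod_sub_eq_zero,
    Int.dvd_iff_emod_eq_zero, Prod.fst_sub, Prod.snd_sub]

lemma vecMod_vecMod {d e : ℤ} (h : d ∣ e) (v : ℤ × ℤ) : vecMod d (vecMod e v) = vecMod d v := by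
  simp [vecMod, Int.emod_emod_of_dvd _ h]

/-- A residue class modulo `d` splits into at most `q ^ 2` residue classes modulo `d * q`. -/
lemma card_le_of_vecMod_eq {d q : ℕ} (hd : 0 < d) (hq : 0 < q) (s : Finset (ℤ × ℤ))
    (hs : ∀ v ∈ s, vecMod (d * q : ℕ) v = v) (r : ℤ × ℤ) (hr : ∀ v ∈ s, vecMod d v = r) :
    s.card ≤ q ^ 2 := by
  have hd' : (0 : ℤ) < d := by exact_mod_cast hd
  have hdq' : (0 : ℤ) < (d * q : ℕ) := by exact_mod_cast Nat.mul_pos hd hq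
  have h : s.card ≤ (Finset.Ico (0 : ℤ) q ×ˢ Finset.Ico (0 : ℤ) q).card := by
    refine Finset.card_le_card_of_injOn (fun v => (v.1 / d, v.2 / d)) ?_ ?_
    · intro v hv
      have h1 := congrArg Prod.fst (hs v hv)
      have h2 := congrArg Prod.snd (hs v hv)
      simp only [vecMod] at h1 h2
      have h3 := Int.emod_nonneg v.1 hdq'.ne'
      have h4 := Int.emod_nonneg v.2 hdq'.ne'
      have h5 := Int.emod_lt_of_pos v.1 hdq'
      have h6 := Int.emod_lt_of_pos v.2 hdq'
      rw [h1] at h3 h5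
      rw [h2] at h4 h6
      push_cast at h5 h6
      simp only [Finset.coe_product, Finset.coe_Ico, Set.mem_prod, Set.mem_Ico]
      exact ⟨⟨Int.ediv_nonneg h3 hd'.le, Int.ediv_lt_of_lt_mul hd' (by linarith)⟩,
        Int.ediv_nonneg h4 hd'.le, Int.ediv_lt_of_lt_mul hd' (by linarith)⟩
    · intro v hv w hw hvw
      have h1 := (hr v hv).trans (hr w hw).symm
      simp only [vecMod, Prod.mk.injEq] at h1 hvw
      ext
      · rw [← Int.emod_add_mul_ediv v.1 d, ← Int.emod_add_mul_ediv w.1 d, h1.1, hvw.1]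
      · rw [← Int.emod_add_mul_ediv v.2 d, ← Int.emod_add_mul_ediv w.2 d, h1.2, hvw.2]
  refine h.trans (le_of_eq ?_)
  simp [sq]

lemma vecDvd_iff_forall_dvd_vecDot {d : ℤ} {v : ℤ × ℤ} {Q e : ℤ} (hQ : Q = e * d) (he : e ≠ 0) :
    VecDvd d v ↔ ∀ w, VecDvd e w → Q ∣ vecDot v w := by
  subst hQ
  constructor
  · intro h w hw
    rw [mul_comm]
    exact h.dvd_vecDot hw
  · intro h
    have h1 := h (e, 0) ⟨dvd_rfl, dvd_zero _⟩
    have h2 := h (0, e) ⟨dvd_zero _, dvd_rfl⟩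
    simp only [vecDot, mul_zero, add_zero, zero_add] at h1 h2
    rw [mul_comm] at h1 h2
    exact ⟨(mul_dvd_mul_iff_right he).1 h1, (mul_dvd_mul_iff_right he).1 h2⟩

/-- Points of a circle have distinct residues modulo large powers. -/
lemma eq_of_vecDvd {R d : ℤ} {z w : ℤ × ℤ} (hd0 : 0 < d) (hd : 4 * R < d ^ 2)
    (hz : z.1 ^ 2 + z.2 ^ 2 = R) (hw : w.1 ^ 2 + w.2 ^ 2 = R) (h : VecDvd d (z - w)) : z = w := by
  have key : ∀ a b c e : ℤ, a ^ 2 + c ^ 2 = R → b ^ 2 + e ^ 2 = R → d ∣ a - b → a = b := by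
    intro a b c e h1 h2 h3
    rw [← sub_eq_zero]
    refine Int.eq_zero_of_abs_lt_dvd h3 (abs_lt_of_sq_lt_sq ?_ hd0.le)
    nlinarith [sq_nonneg (a + b), sq_nonneg c, sq_nonneg e]
  ext
  · exact key _ _ _ _ hz hw h.1
  · exact key _ _ z.1 w.1 (by linarith) (by linarith) h.2

end CircleCharacters

/-- The tree of residue classes modulo powers of `q` of points of a circle which are congruent
modulo `q ^ j`. -/
noncomputable def circleTree (q R j n N : ℕ) (hN : j + n + 1 = N) (hq : q.Prime)
    (hq2 : q ≠ 2) (hqR : ¬ q ∣ R) (hj : 1 ≤ j) [NeZero (q ^ (2 * N))] (hR : 4 * R < q ^ (2 * N))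
    (B : Finset (ℤ × ℤ)) (hB : ∀ z ∈ B, z.1 ^ 2 + z.2 ^ 2 = (R : ℤ)) (w₀ : ℤ × ℤ)
    (hBw : ∀ z ∈ B, VecDvd ((q : ℤ) ^ j) (z - w₀)) :
    CapTree (ZMod (q ^ (2 * N)) × ZMod (q ^ (2 * N))) B (ℤ × ℤ) :=
  have hqp : Prime (q : ℤ) := Nat.prime_iff_prime_int.1 hq
  have hq0 : (q : ℤ) ≠ 0 := hqp.ne_zero
  have h2 : ¬ (q : ℤ) ∣ 2 := fun h =>
    hq2 ((Nat.prime_dvd_prime_iff_eq hq Nat.prime_two).1 (by exact_mod_cast h))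
  have hRq : ¬ (q : ℤ) ∣ R := fun h => hqR (by exact_mod_cast h)
  { chi := fun z => vecChar _ z
    cls := fun m z => vecMod ((q : ℤ) ^ (N - m)) z
    par := fun m κ => vecMod ((q : ℤ) ^ (N - (m + 1))) κ
    anc := fun κ => vecMod ((q : ℤ) ^ (N - n)) κ
    n := n
    b := q ^ 2
    D := fun m => (vecMultiples ((q : ℤ) ^ (N + m))).map (vecCast _)
    H := fun m => (vecMultiples ((q : ℤ) ^ (N + m)) ⊔
      AddSubgroup.zmultiples ((q : ℤ) ^ (n + 1 + m) • w₀)).map (vecCast _)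
    par_cls := fun m z => vecMod_vecMod (pow_dvd_pow _ (by omega)) _
    anc_cls := fun m hm z => vecMod_vecMod (pow_dvd_pow _ (by omega)) _
    cls_injective := by
      intro z w h
      rw [vecMod_eq_iff] at h
      refine Subtype.ext (eq_of_vecDvd (R := R) (by positivity) ?_ (hB z z.2) (hB w w.2) h)
      rw [← pow_mul, Nat.sub_zero, mul_comm _ 2]
      exact_mod_cast hR
    card_children := by
      intro m hm κ
      refine card_le_of_vecMod_eq (d := q ^ (N - (m + 1))) (pow_pos hq.pos _) hq.pos _
        (fun v hv => ?_) κ fun v hv => ?_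
      · simp only [Finset.mem_filter, Finset.mem_image] at hv
        obtain ⟨⟨z, -, rfl⟩, -⟩ := hv
        rw [← pow_succ, show N - (m + 1) + 1 = N - m by omega]
        push_cast
        exact vecMod_vecMod dvd_rfl _
      · simp only [Finset.mem_filter] at hv
        rw [Nat.cast_pow]
        exact hv.2
    card_top := by
      refine card_le_of_vecMod_eq (d := q ^ j) (pow_pos hq.pos _) hq.pos _
        (fun v hv => ?_) (vecMod ((q : ℤ) ^ j) w₀) fun v hv => ?_
      · simp only [Finset.mem_image] at hv
        obtain ⟨z, -, rfl⟩ := hv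
        rw [← pow_succ, show N - n = j + 1 by omega]
        push_cast
        exact vecMod_vecMod dvd_rfl _
      · simp only [Finset.mem_image] at hv
        obtain ⟨z, -, rfl⟩ := hv
        push_cast
        rw [vecMod_vecMod (pow_dvd_pow _ (by omega)), vecMod_eq_iff]
        exact hBw z z.2
    D_stab := by
      rintro m hm _ ⟨v, hv, rfl⟩ z z' hzz
      rw [vecMod_eq_iff] at hzz
      rw [vecChar_vecCast_eq_iff]
      push_cast
      rw [show 2 * N = (N - m) + (N + m) by omega, pow_add]
      exact hzz.dvd_vecDot hv
    D_sep := by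
      intro m hm z z' hzz
      by_contra! h
      apply hzz
      rw [vecMod_eq_iff, vecDvd_iff_forall_dvd_vecDot (Q := (q : ℤ) ^ (2 * N))
        (e := (q : ℤ) ^ (N + m))
        (by rw [← pow_add]; congr 1; omega) (pow_ne_zero _ hq0)]
      intro w hw
      have := h _ ⟨w, hw, rfl⟩
      rw [vecChar_vecCast_eq_iff] at this
      exact_mod_cast this
    D_le := by
      rintro m hm κ₁ hκ₁ κ₂ hκ₂ hne _ ⟨v, hv, rfl⟩
      simp only [Finset.mem_image, Finset.mem_univ, true_and] at hκ₁ hκ₂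
      obtain ⟨w, rfl⟩ := hκ₁
      obtain ⟨w', rfl⟩ := hκ₂
      obtain ⟨k, hk⟩ : ∃ k, N - (m + 1) = k + 1 := ⟨j + n - m - 1, by omega⟩
      rw [hk] at hne ⊢
      have hdet : ¬ (q : ℤ) ^ (k + 1) ∣ vecDet w w' := by
        refine not_pow_dvd_vecDet hqp h2 hRq (hB w w.2) (hB w' w'.2) ?_ fun h => hne ?_
        · have := (hBw w' w'.2).sub (hBw w w.2)
          rw [sub_sub_sub_cancel_right] at this
          exact this.of_dvd (dvd_pow_self _ (by omega))
        · exact (vecMod_eq_iff.2 h).symm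
      obtain ⟨c, c', a, hv'⟩ := exists_add_eq_of_not_dvd_vecDet hqp (s := 2 * m + 2) hdet
        (v := v) (by rw [show 2 * m + 2 + k = N + m by omega]; exact hv)
      have hstab : ∀ (u : B) (c : ℤ) (z z' : B),
          vecMod ((q : ℤ) ^ (k + 1)) z = vecMod ((q : ℤ) ^ (k + 1)) u →
          vecMod ((q : ℤ) ^ (k + 1)) z' = vecMod ((q : ℤ) ^ (k + 1)) u →
          (q : ℤ) ^ (2 * N) ∣ vecDot (z - z') (((q : ℤ) ^ (2 * m + 2) * c) • u) := by
        intro u c z z' hz hz'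
        rw [vecMod_eq_iff] at hz hz'
        have h1 := dvd_sub (pow_dvd_vecDot_chord hqp h2 (hB z z.2) (hB u u.2) hz)
          (pow_dvd_vecDot_chord hqp h2 (hB z' z'.2) (hB u u.2) hz')
        have e : vecDot ((z : ℤ × ℤ) - z') (((q : ℤ) ^ (2 * m + 2) * c) • (u : ℤ × ℤ)) =
            (q : ℤ) ^ (2 * m + 2) * (vecDot ((z : ℤ × ℤ) - u) u - vecDot ((z' : ℤ × ℤ) - u) u) *
              c := by
          simp only [vecDot, Prod.fst_sub, Prod.snd_sub, Prod.smul_fst, Prod.smul_snd, smul_eq_mul]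
          ring
        rw [e, show 2 * N = (2 * m + 2) + 2 * (k + 1) by omega, pow_add]
        exact (mul_dvd_mul_left _ h1).mul_right _
      refine ⟨vecCast _ (((q : ℤ) ^ (2 * m + 2) * c) • (w : ℤ × ℤ) +
        (q : ℤ) ^ (2 * m + 2 + k + 1) • a),
        vecCast _ (((q : ℤ) ^ (2 * m + 2) * c') • (w' : ℤ × ℤ)), by rw [← map_add, hv'], ?_, ?_⟩
      · intro z z' hz hz'
        rw [vecChar_vecCast_eq_iff]
        push_cast
        have e : ∀ u v w : ℤ × ℤ, vecDot u (v + w) = vecDot u v + vecDot u w := by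
          intro u v w; simp only [vecDot, Prod.fst_add, Prod.snd_add]; ring
        rw [e]
        refine dvd_add (hstab w c z z' hz hz') ?_
        rw [show 2 * N = (k + 1) + (2 * m + 2 + k + 1) by omega, pow_add]
        exact (vecMod_eq_iff.1 (hz.trans hz'.symm)).dvd_vecDot
          ⟨dvd_mul_right _ _, dvd_mul_right _ _⟩
      · intro z z' hz hz'
        rw [vecChar_vecCast_eq_iff]
        push_cast
        exact hstab w' c' z z' hz hz'
    H_stab := by
      rintro m hm hmn _ ⟨v, hv, rfl⟩ z z' hzz
      rw [vecMod_eq_iff] at hzz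
      obtain ⟨a, ha, _, ⟨s, rfl⟩, rfl⟩ := AddSubgroup.mem_sup.1 hv
      rw [vecChar_vecCast_eq_iff]
      push_cast
      have e : vecDot ((z : ℤ × ℤ) - z') (a + s • (q : ℤ) ^ (n + 1 + m) • w₀) =
          vecDot ((z : ℤ × ℤ) - z') a + (q : ℤ) ^ (n + 1 + m) *
            (vecDot ((z : ℤ × ℤ) - z') z' - vecDot ((z : ℤ × ℤ) - z') ((z' : ℤ × ℤ) - w₀)) * s := by
        simp only [vecDot, Prod.fst_sub, Prod.snd_sub, Prod.fst_add, Prod.snd_add, Prod.smul_fst,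
          Prod.smul_snd, smul_eq_mul]
        ring
      rw [e]
      refine dvd_add ?_ (Dvd.dvd.mul_right ?_ _)
      · rw [show 2 * N = (N - m) + (N + m) by omega, pow_add]
        exact hzz.dvd_vecDot ha
      · rw [show 2 * N = (n + 1 + m) + ((N - m) + j) by omega, pow_add]
        refine mul_dvd_mul_left _ (dvd_sub ?_ ?_)
        · exact (pow_dvd_pow _ (by omega)).trans
            (pow_dvd_vecDot_chord hqp h2 (hB z z.2) (hB z' z'.2) hzz)
        · rw [pow_add]
          exact hzz.dvd_vecDot (hBw z' z'.2)
    H_sep := by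
      intro m hm hmn z₁ z₂ w₁ w₂ hz hw hne h
      have hj1 : N - n = j + 1 := by omega
      rw [hj1] at hz hw hne
      rw [Ne, vecMod_eq_iff] at hne
      rw [vecMod_eq_iff] at hz hw
      have h' : ∀ v ∈ vecMultiples ((q : ℤ) ^ (N + m)) ⊔
          AddSubgroup.zmultiples ((q : ℤ) ^ (n + 1 + m) • w₀),
          (q : ℤ) ^ (2 * N) ∣ vecDot ((z₁ : ℤ × ℤ) + w₁ - (z₂ + w₂)) v := by
        intro v hv
        have := h _ ⟨v, hv, rfl⟩
        rw [← vecChar_add, ← vecChar_add, vecChar_vecCast_eq_iff] at this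
        exact_mod_cast this
      rw [vecMod_eq_iff, vecMod_eq_iff]
      refine vecDvd_chords_of_bilinear hqp h2 hRq hj (hB z₁ z₁.2) (hB z₂ z₂.2) (hB w₁ w₁.2)
        (hB w₂ w₂.2) (hBw z₁ z₁.2) (hBw w₁ w₁.2) hz hw hne ?_ ?_
      · rw [vecDvd_iff_forall_dvd_vecDot (Q := (q : ℤ) ^ (2 * N))
          (e := (q : ℤ) ^ (N + m))
          (by rw [← pow_add]; congr 1; omega) (pow_ne_zero _ hq0)]
        exact fun v hv => h' v (AddSubgroup.mem_sup_left hv)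
      · have h1 := h' _ (AddSubgroup.mem_sup_right (AddSubgroup.mem_zmultiples _))
        have e : vecDot ((z₁ : ℤ × ℤ) + w₁ - (z₂ + w₂)) ((q : ℤ) ^ (n + 1 + m) • w₀) =
            (q : ℤ) ^ (n + 1 + m) * vecDot ((z₁ : ℤ × ℤ) + w₁ - (z₂ + w₂)) w₀ := by
          simp only [vecDot, Prod.smul_fst, Prod.smul_snd, smul_eq_mul]
          ring
        rw [e, show 2 * N = (n + 1 + m) + ((N - m) + j) by omega, pow_add] at h1
        exact (mul_dvd_mul_iff_left (pow_ne_zero _ hq0)).1 h1 }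

section CircleMoment

/-- The unnormalized sixth moment of the sum of the characters with frequencies in `B`. -/
noncomputable def vecMoment (Q : ℕ) [NeZero Q] (B : Finset (ℤ × ℤ)) : ℝ :=
  ∑ x, ‖∑ z ∈ B, vecChar Q z x‖ ^ 6

lemma sum_card_filter_pow_three_le {α β : Type*} [DecidableEq β] (B : Finset α) (f : α → β) :
    ∑ c ∈ B.image f, ((B.filter (f · = c)).card : ℝ) ^ 3 ≤ (B.card : ℝ) ^ 3 := by
  have h : ∀ c ∈ B.image f, ((B.filter (f · = c)).card : ℝ) ^ 3 ≤
      (B.card : ℝ) ^ 2 * (B.filter (f · = c)).card := by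
    intro c _
    rw [pow_succ]
    gcongr
    exact Finset.filter_subset _ _
  refine (Finset.sum_le_sum h).trans (le_of_eq ?_)
  rw [← Finset.mul_sum, ← Nat.cast_sum, ← Finset.card_eq_sum_card_image]
  ring

variable {q R N : ℕ} [NeZero (q ^ (2 * N))]

lemma vecMoment_le_sum_filter (hq : q.Prime) (hq2 : q ≠ 2) (hqR : ¬ q ∣ R)
    (hR : 4 * R < q ^ (2 * N)) {j n : ℕ} (hN : j + n + 1 = N) (hj : 1 ≤ j) {B : Finset (ℤ × ℤ)}
    (hB : ∀ z ∈ B, z.1 ^ 2 + z.2 ^ 2 = (R : ℤ)) (hne : B.Nonempty)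
    (hBq : ∀ z ∈ B, ∀ w ∈ B, VecDvd ((q : ℤ) ^ j) (z - w)) :
    vecMoment (q ^ (2 * N)) B ≤
      64 * ∑ c ∈ B.image (vecMod ((q : ℤ) ^ (j + 1))),
        vecMoment (q ^ (2 * N)) (B.filter (vecMod ((q : ℤ) ^ (j + 1)) · = c)) +
      2 ^ 22 * (Nat.log 2 B.card + 1) * (q ^ 2) ^ 8 * 8 ^ n *
        (((q : ℝ) ^ (2 * N)) ^ 2 * B.card ^ 3) := by
  obtain ⟨w₀, hw₀⟩ := hne
  have : Nonempty B := ⟨⟨w₀, hw₀⟩⟩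
  have key := (circleTree q R j n N hN hq hq2 hqR hj hR B hB w₀
    fun z hz => hBq z hz w₀ hw₀).sum_norm_pow_six_le
  have hj1 : N - n = j + 1 := by omega
  have h1 : ∀ x, ∑ z : B, (vecChar (q ^ (2 * N)) z) x = ∑ z ∈ B, vecChar (q ^ (2 * N)) z x :=
    fun x => Finset.sum_coe_sort B fun z => vecChar (q ^ (2 * N)) z x
  have h2 : Finset.univ.image (fun z : B => vecMod ((q : ℤ) ^ (j + 1)) z) =
      B.image (vecMod ((q : ℤ) ^ (j + 1))) := by
    ext c; simp
  have h3 : ∀ c x, ∑ z ∈ Finset.univ.filter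
      (fun z : B => vecMod ((q : ℤ) ^ (j + 1)) z = c), (vecChar (q ^ (2 * N)) z) x =
      ∑ z ∈ B with vecMod ((q : ℤ) ^ (j + 1)) z = c, vecChar (q ^ (2 * N)) z x := by
    intro c x
    rw [Finset.sum_filter, Finset.sum_filter]
    exact Finset.sum_coe_sort B fun z =>
      if vecMod ((q : ℤ) ^ (j + 1)) z = c then vecChar (q ^ (2 * N)) z x else 0
  simp only [vecMoment, ← h1, ← h2, ← h3]
  simp only [circleTree, CapTree.classes, hj1, Fintype.card_prod, ZMod.card,
    Fintype.card_coe] at key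
  push_cast at key
  rw [← sq] at key
  convert key using 8

lemma vecMoment_le_of_vecDvd (hq : q.Prime) (hq2 : q ≠ 2) (hqR : ¬ q ∣ R)
    (hR : 4 * R < q ^ (2 * N)) {I d j : ℕ} (hdj : j + d = N) (hj : 1 ≤ j) (B : Finset (ℤ × ℤ))
    (hB : ∀ z ∈ B, z.1 ^ 2 + z.2 ^ 2 = (R : ℤ)) (hI : Nat.log 2 B.card ≤ I)
    (hBq : ∀ z ∈ B, ∀ w ∈ B, VecDvd ((q : ℤ) ^ j) (z - w)) :
    vecMoment (q ^ (2 * N)) B ≤ 65 ^ d * (2 ^ 22 * (I + 1) * (q ^ 2) ^ 8 * 8 ^ N) *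
      (((q : ℝ) ^ (2 * N)) ^ 2 * B.card ^ 3) := by
  have hq1 : (1 : ℝ) ≤ q := by exact_mod_cast hq.one_lt.le
  have hY : (1 : ℝ) ≤ 2 ^ 22 * (I + 1) * (q ^ 2) ^ 8 * 8 ^ N := by
    refine one_le_mul_of_one_le_of_one_le (one_le_mul_of_one_le_of_one_le
      (one_le_mul_of_one_le_of_one_le (by norm_num) ?_) (one_le_pow₀ (one_le_pow₀ hq1)))
      (one_le_pow₀ (by norm_num))
    have : (0 : ℝ) ≤ I := by positivity
    linarith
  set Y : ℝ := 2 ^ 22 * (I + 1) * (q ^ 2) ^ 8 * 8 ^ N with hYdef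
  rcases B.eq_empty_or_nonempty with rfl | hne
  · simp [vecMoment]
  induction d generalizing j B with
  | zero =>
    obtain ⟨w, hw⟩ := hne
    have : B = {w} := by
      refine Finset.eq_singleton_iff_unique_mem.2 ⟨hw, fun z hz => ?_⟩
      refine eq_of_vecDvd (R := R) (d := (q : ℤ) ^ j) (by have := hq.pos; positivity) ?_ (hB z hz)
        (hB w hw) (hBq z hz w hw)
      rw [← pow_mul, mul_comm j 2, show j = N by omega]
      exact_mod_cast hR
    subst this
    simp only [vecMoment, Finset.sum_singleton, AddChar.norm_apply, one_pow, Finset.sum_const,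
      Finset.card_univ, Fintype.card_prod, ZMod.card, nsmul_eq_mul, pow_zero, one_mul, mul_one,
      Finset.card_singleton, Nat.cast_one]
    push_cast
    rw [← sq]
    exact le_mul_of_one_le_left (by positivity) hY
  | succ d ih =>
    refine (vecMoment_le_sum_filter hq hq2 hqR hR (n := d) (by omega) hj hB hne hBq).trans ?_
    set X : ℝ := ((q : ℝ) ^ (2 * N)) ^ 2
    have h1 : ∀ c ∈ B.image (vecMod ((q : ℤ) ^ (j + 1))),
        vecMoment (q ^ (2 * N)) (B.filter (vecMod ((q : ℤ) ^ (j + 1)) · = c)) ≤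
          65 ^ d * Y * X * ((B.filter (vecMod ((q : ℤ) ^ (j + 1)) · = c)).card : ℝ) ^ 3 := by
      intro c hc
      have hsub : B.filter (vecMod ((q : ℤ) ^ (j + 1)) · = c) ⊆ B := Finset.filter_subset _ _
      rw [mul_assoc]
      refine ih (j := j + 1) (by omega) (by omega) _ (fun z hz => hB z (hsub hz))
        ((Nat.log_mono_right (Finset.card_le_card hsub)).trans hI) (fun z hz w hw => ?_) ?_
      · rw [Finset.mem_filter] at hz hw
        exact vecMod_eq_iff.1 (hz.2.trans hw.2.symm)
      · obtain ⟨z, hz, rfl⟩ := Finset.mem_image.1 hc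
        exact ⟨z, Finset.mem_filter.2 ⟨hz, rfl⟩⟩
    have h2 := Finset.sum_le_sum h1
    rw [← Finset.mul_sum] at h2
    have h3 : (2 : ℝ) ^ 22 * (Nat.log 2 B.card + 1) * (q ^ 2) ^ 8 * 8 ^ d ≤ Y := by
      rw [hYdef]
      gcongr
      · norm_num
      · omega
    have h4 : (1 : ℝ) ≤ 65 ^ d := one_le_pow₀ (by norm_num)
    have hX : 0 ≤ X := by positivity
    calc _ ≤ 64 * (65 ^ d * Y * X * (B.card : ℝ) ^ 3) + 65 ^ d * Y * (X * B.card ^ 3) := by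
          refine add_le_add (mul_le_mul_of_nonneg_left (h2.trans ?_) (by norm_num))
            (mul_le_mul_of_nonneg_right (h3.trans (le_mul_of_one_le_left (by linarith) h4))
              (by positivity))
          gcongr
          exact sum_card_filter_pow_three_le _ _
      _ = _ := by ring

lemma vecMoment_le (hq : q.Prime) (hq2 : q ≠ 2) (hqR : ¬ q ∣ R)
    (hR : 4 * R < q ^ (2 * N)) (hN : 1 ≤ N) (B : Finset (ℤ × ℤ))
    (hB : ∀ z ∈ B, z.1 ^ 2 + z.2 ^ 2 = (R : ℤ)) :
    vecMoment (q ^ (2 * N)) B ≤ 2 ^ 22 * (Nat.log 2 B.card + 1) * q ^ 26 * 520 ^ N *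
      (((q : ℝ) ^ (2 * N)) ^ 2 * B.card ^ 3) := by
  set s := B.image (vecMod (q : ℤ))
  set F : ℤ × ℤ → Finset (ℤ × ℤ) := fun c => B.filter (vecMod (q : ℤ) · = c)
  set Y : ℝ := 2 ^ 22 * (Nat.log 2 B.card + 1) * (q ^ 2) ^ 8 * 8 ^ N with hYdef
  set X : ℝ := ((q : ℝ) ^ (2 * N)) ^ 2
  have hs : (s.card : ℝ) ≤ q ^ 2 := by
    have := card_le_of_vecMod_eq (d := 1) (q := q) one_pos hq.pos s
      (fun v hv => by
        obtain ⟨z, -, rfl⟩ := Finset.mem_image.1 hv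
        rw [one_mul]
        exact vecMod_vecMod dvd_rfl z) (0, 0) (fun v _ => by simp [vecMod])
    exact_mod_cast this
  have h1 : ∀ c ∈ s, vecMoment (q ^ (2 * N)) (F c) ≤
      65 ^ N * Y * X * ((F c).card : ℝ) ^ 3 := by
    intro c _
    have hsub : F c ⊆ B := Finset.filter_subset _ _
    have := vecMoment_le_of_vecDvd hq hq2 hqR hR (d := N - 1) (j := 1) (by omega) le_rfl (F c)
      (fun z hz => hB z (hsub hz)) (Nat.log_mono_right (Finset.card_le_card hsub))
      (fun z hz w hw => by
        rw [Finset.mem_filter] at hz hw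
        rw [pow_one]
        exact vecMod_eq_iff.1 (hz.2.trans hw.2.symm))
    refine this.trans ?_
    rw [mul_assoc _ X]
    gcongr
    · norm_num
    · omega
  have h2 : ∀ x, ‖∑ z ∈ B, vecChar (q ^ (2 * N)) z x‖ ^ 6 ≤
      ((q : ℝ) ^ 2) ^ 5 * ∑ c ∈ s, ‖∑ z ∈ F c, vecChar (q ^ (2 * N)) z x‖ ^ 6 := by
    intro x
    rw [← Finset.sum_fiberwise_of_maps_to (s := B) (t := s)
      (fun z hz => Finset.mem_image_of_mem _ hz)]
    have h3 := pow_sum_le_card_mul_sum_pow (s := s)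
      (f := fun c => ‖∑ z ∈ F c, vecChar (q ^ (2 * N)) z x‖) (fun _ _ => norm_nonneg _) 5
    calc _ ≤ (∑ c ∈ s, ‖∑ z ∈ F c, vecChar (q ^ (2 * N)) z x‖) ^ 6 := by
          gcongr; exact norm_sum_le _ _
      _ ≤ _ := h3
      _ ≤ _ := by gcongr
  have h3 : ∑ c ∈ s, ((F c).card : ℝ) ^ 3 ≤ (B.card : ℝ) ^ 3 := sum_card_filter_pow_three_le _ _
  have h520 : (520 : ℝ) ^ N = 65 ^ N * 8 ^ N := by rw [← mul_pow]; norm_num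
  calc vecMoment (q ^ (2 * N)) B
      ≤ ((q : ℝ) ^ 2) ^ 5 * ∑ c ∈ s, vecMoment (q ^ (2 * N)) (F c) := by
        simp only [vecMoment]
        rw [Finset.sum_comm, Finset.mul_sum]
        exact Finset.sum_le_sum fun x _ => h2 x
    _ ≤ ((q : ℝ) ^ 2) ^ 5 * (65 ^ N * Y * X * (B.card : ℝ) ^ 3) := by
        gcongr
        refine (Finset.sum_le_sum h1).trans ?_
        rw [← Finset.mul_sum]
        gcongr
    _ = _ := by rw [hYdef, h520]; ring

end CircleMoment

section SixthOrderCorrelation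

lemma vecChar_neg {Q : ℕ} [NeZero Q] (z : ℤ × ℤ) (x : ZMod Q × ZMod Q) :
    vecChar Q (-z) x = (starRingEnd ℂ) (vecChar Q z x) := by
  rw [← AddChar.map_neg_eq_conj, vecChar_apply, vecChar_apply]
  congr 1
  simp only [Prod.fst_neg, Prod.snd_neg]
  push_cast
  ring

/-- The sixth moment counts the additive relations between six frequencies. -/
lemma card_mul_le_vecMoment (Q : ℕ) [NeZero Q] (A : Finset (ℤ × ℤ)) :
    (((Fintype.piFinset fun _ : Fin 6 => A).filter
      fun z => z 0 + z 1 + z 2 = z 3 + z 4 + z 5).card : ℝ) * (Q : ℝ) ^ 2 ≤ vecMoment Q A := by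
  classical
  set e : (Fin 6 → ℤ × ℤ) → ℤ × ℤ := fun z => z 0 + z 1 + z 2 + -z 3 + -z 4 + -z 5
  have h1 : ∀ x, ((‖∑ z ∈ A, vecChar Q z x‖ ^ 6 : ℝ) : ℂ) =
      ∑ z ∈ Fintype.piFinset fun _ : Fin 6 => A, vecChar Q (e z) x := by
    intro x
    have h2 : ((‖∑ z ∈ A, vecChar Q z x‖ ^ 6 : ℝ) : ℂ) =
        ∏ i : Fin 6, ∑ z ∈ A, if i < 3 then vecChar Q z x else vecChar Q (-z) x := by
      have h3 : ∀ w : ℂ, ((‖w‖ ^ 6 : ℝ) : ℂ) = w ^ 3 * (starRingEnd ℂ) w ^ 3 := by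
        intro w
        rw [← mul_pow, Complex.mul_conj, Complex.normSq_eq_norm_sq]
        push_cast
        ring
      rw [h3, Fin.prod_univ_six, map_sum]
      simp only [← vecChar_neg]
      norm_num [Fin.lt_def]
      ring
    rw [h2, Finset.prod_univ_sum]
    refine Finset.sum_congr rfl fun z _ => ?_
    rw [Fin.prod_univ_six]
    simp only [e, vecChar_add]
    norm_num [Fin.lt_def]
  have h2 : (vecMoment Q A : ℂ) = ((∑ z ∈ Fintype.piFinset fun _ : Fin 6 => A,
      if vecChar Q (e z) = 0 then (Q : ℝ) ^ 2 else 0 : ℝ) : ℂ) := by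
    rw [vecMoment, Complex.ofReal_sum]
    simp_rw [h1]
    rw [Finset.sum_comm, Complex.ofReal_sum]
    refine Finset.sum_congr rfl fun z _ => ?_
    rw [AddChar.sum_eq_ite]
    split_ifs <;> simp [sq, ZMod.card]
  rw [Complex.ofReal_inj] at h2
  rw [h2, ← nsmul_eq_mul, ← Finset.sum_const, Finset.sum_filter]
  refine Finset.sum_le_sum fun z _ => ?_
  split_ifs with h3 h4 h4
  · exact le_rfl
  · refine absurd ?_ h4
    have : e z = 0 := by
      simp only [e]
      rw [h3]
      abel
    ext x
    simp [this, vecChar_apply]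
  · positivity
  · exact le_rfl

/-- Many primes in a geometric range. -/
lemma exists_finset_primes {n : ℕ} (hn : n ≠ 0) (t : ℕ) :
    ∃ S : Finset ℕ, S.card = t ∧ ∀ p ∈ S, p.Prime ∧ n < p ∧ p ≤ 2 ^ t * n := by
  induction t with
  | zero => exact ⟨∅, by simp⟩
  | succ t ih =>
    obtain ⟨S, hS, h⟩ := ih
    obtain ⟨p, hp, hnp, hpn⟩ := Nat.exists_prime_lt_and_le_two_mul (2 ^ t * n) (by positivity)
    have h1 : 2 ^ (t + 1) * n = 2 * (2 ^ t * n) := by ring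
    have h2 : n ≤ 2 ^ t * n := Nat.le_mul_of_pos_left _ (by positivity)
    refine ⟨insert p S, ?_, ?_⟩
    · rw [Finset.card_insert_of_notMem fun hpS => (h p hpS).2.2.not_gt hnp, hS]
    · intro r hr
      rcases Finset.mem_insert.1 hr with rfl | hr
      · exact ⟨hp, h2.trans_lt hnp, by omega⟩
      · have := h r hr
        exact ⟨this.1, this.2.1, by omega⟩

lemma exists_prime_not_dvd {n R t : ℕ} (hn : n ≠ 0) (hR : R ≠ 0) (h : R < n ^ t) :
    ∃ p : ℕ, p.Prime ∧ n < p ∧ p ≤ 2 ^ t * n ∧ ¬ p ∣ R := by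
  obtain ⟨S, hS, hp⟩ := exists_finset_primes hn t
  by_contra! hdvd
  have h1 : ∏ p ∈ S, p ∣ R := Finset.prod_primes_dvd R (fun p hpS => (hp p hpS).1.prime)
    fun p hpS => hdvd p (hp p hpS).1 (hp p hpS).2.1 (hp p hpS).2.2
  have h2 : n ^ t ≤ ∏ p ∈ S, p := by
    rw [← hS]
    exact Finset.pow_card_le_prod _ _ _ fun p hpS => (hp p hpS).2.1.le
  exact absurd (h2.trans (Nat.le_of_dvd (Nat.pos_of_ne_zero hR) h1)) h.not_ge

/-- The points of the circle of radius `√R`. -/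
noncomputable def circlePoints (R : ℕ) : Finset (ℤ × ℤ) :=
  (Finset.Icc (-(R : ℤ)) R ×ˢ Finset.Icc (-(R : ℤ)) R).filter fun z => z.1 ^ 2 + z.2 ^ 2 = R

lemma mem_circlePoints {R : ℕ} {z : ℤ × ℤ} : z ∈ circlePoints R ↔ z.1 ^ 2 + z.2 ^ 2 = (R : ℤ) := by
  simp only [circlePoints, Finset.mem_filter, Finset.mem_product, Finset.mem_Icc,
    and_iff_right_iff_imp]
  intro h
  have key : ∀ a b : ℤ, a ^ 2 + b ^ 2 = R → -(R : ℤ) ≤ a ∧ a ≤ R := by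
    intro a b hab
    have h1 := Int.le_self_sq a
    have h2 := Int.le_self_sq (-a)
    constructor <;> nlinarith [sq_nonneg b]
  exact ⟨key _ _ h, key _ z.1 (by linarith)⟩

/-- The sixth-order energy of a circle, for an admissible scale `s`. -/
lemma card_filter_circlePoints_le {R s : ℕ} (hR : 4 ≤ R) (hs : R < 3 ^ (s * s)) :
    (((Fintype.piFinset fun _ : Fin 6 => circlePoints R).filter
      fun z => z 0 + z 1 + z 2 = z 3 + z 4 + z 5).card : ℝ) ≤
      2 ^ 22 * (Nat.log 2 (circlePoints R).card + 1) * Real.exp (60 * s) *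
        (circlePoints R).card ^ 3 := by
  have hs0 : s ≠ 0 := by
    rintro rfl
    simp at hs
    omega
  rw [pow_mul] at hs
  obtain ⟨q, hq, hnq, hqn, hqR⟩ := exists_prime_not_dvd (by positivity) (by omega) hs
  have hq2 : q ≠ 2 := by
    have := Nat.pow_le_pow_right (show 0 < 3 by norm_num) (Nat.one_le_iff_ne_zero.2 hs0)
    omega
  have hq0 : 0 < q := hq.pos
  have : NeZero (q ^ (2 * s)) := ⟨by positivity⟩
  have hRq : 4 * R < q ^ (2 * s) := by
    have h1 : R < q ^ s := hs.trans_le (Nat.pow_le_pow_left hnq.le s)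
    rw [mul_comm 2, pow_mul]
    nlinarith
  have h1 := (card_mul_le_vecMoment (q ^ (2 * s)) (circlePoints R)).trans
    (vecMoment_le hq hq2 hqR hRq (Nat.one_le_iff_ne_zero.2 hs0) (circlePoints R)
      fun z => mem_circlePoints.1)
  have hX : (0 : ℝ) < ((q : ℝ) ^ (2 * s)) ^ 2 := by
    have : (0 : ℝ) < q := by exact_mod_cast hq0
    positivity
  push_cast at h1
  rw [mul_left_comm, mul_comm _ (((q : ℝ) ^ (2 * s)) ^ 2)] at h1
  refine (le_of_mul_le_mul_left h1 hX).trans ?_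
  have he : (2.7 : ℝ) ≤ Real.exp 1 := by linarith [Real.exp_one_gt_d9]
  have hexp : ∀ k : ℕ, (2.7 : ℝ) ^ k ≤ Real.exp k := by
    intro k
    rw [← Real.exp_one_pow]
    gcongr
  have h6 : (q : ℝ) ≤ Real.exp 2 ^ s := by
    have h2 : (q : ℝ) ≤ 2 ^ s * 3 ^ s := by exact_mod_cast hqn
    rw [← mul_pow] at h2
    refine h2.trans ?_
    gcongr
    have := hexp 2
    norm_num at this ⊢
    linarith
  have h520 : (520 : ℝ) ≤ Real.exp 7 := by
    have := hexp 7
    norm_num at this ⊢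
    linarith
  have h2 : (q : ℝ) ^ 26 * 520 ^ s ≤ Real.exp (60 * s) := by
    calc (q : ℝ) ^ 26 * 520 ^ s ≤ (Real.exp 2 ^ s) ^ 26 * Real.exp 7 ^ s := by gcongr
      _ = Real.exp (59 * s) := by
        rw [← Real.exp_nat_mul, ← Real.exp_nat_mul, ← Real.exp_nat_mul, ← Real.exp_add]
        congr 1
        push_cast
        ring
      _ ≤ _ := by
        gcongr
        norm_num
  rw [mul_assoc _ ((q : ℝ) ^ 26)]
  gcongr

lemma natLog_add_one_le_rpow {κ : ℝ} (hκ : 0 < κ) {n : ℕ} (hn : n ≠ 0) :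
    (Nat.log 2 n + 1 : ℝ) ≤ (2 / κ + 1) * (n : ℝ) ^ κ := by
  have hn1 : (1 : ℝ) ≤ n := by exact_mod_cast Nat.one_le_iff_ne_zero.2 hn
  have h1 : (Nat.log 2 n : ℝ) ≤ Real.log n / Real.log 2 := Real.natLog_le_logb n 2
  have h2 : Real.log n / Real.log 2 ≤ 2 * Real.log n := by
    rw [div_le_iff₀ (Real.log_pos (by norm_num))]
    nlinarith [Real.log_nonneg hn1, Real.log_two_gt_d9]
  have h3 := Real.log_le_rpow_div (zero_le_one.trans hn1) hκ
  have h4 : (1 : ℝ) ≤ (n : ℝ) ^ κ := Real.one_le_rpow hn1 hκ.le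
  have h5 : 2 / κ * (n : ℝ) ^ κ = 2 * ((n : ℝ) ^ κ / κ) := by ring
  linarith

lemma eventually_exp_le_exp_rpow {κ : ℝ} (hκ : 0 < κ) :
    ∀ᶠ R : ℕ in Filter.atTop, Real.exp (60 * ⌈√(Real.log R)⌉₊) ≤
      Real.exp (Real.log R ^ (1 - 1 / 4 : ℝ)) ^ κ := by
  have h1 : Filter.Tendsto (fun R : ℕ => Real.log R ^ (1 / 4 : ℝ)) Filter.atTop Filter.atTop :=
    (tendsto_rpow_atTop (by norm_num)).comp
      (Real.tendsto_log_atTop.comp tendsto_natCast_atTop_atTop)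
  filter_upwards [h1.eventually_ge_atTop 1, h1.eventually_ge_atTop (120 / κ)] with R h2 h3
  have hL : 0 ≤ Real.log R := Real.log_natCast_nonneg R
  set u := Real.log R ^ (1 / 4 : ℝ)
  have hu2 : √(Real.log R) = u ^ 2 := by
    rw [Real.sqrt_eq_rpow, ← Real.rpow_natCast, ← Real.rpow_mul hL]
    norm_num
  have hu3 : Real.log R ^ (1 - 1 / 4 : ℝ) = u ^ 3 := by
    rw [← Real.rpow_natCast, ← Real.rpow_mul hL]
    norm_num
  rw [hu2, hu3, ← Real.exp_mul, Real.exp_le_exp]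
  have h4 := Nat.ceil_lt_add_one (sq_nonneg u)
  rw [div_le_iff₀ hκ] at h3
  nlinarith [mul_le_mul_of_nonneg_right h3 (sq_nonneg u)]

lemma lt_three_pow_ceil_sqrt_log {R : ℕ} (hR : 2 ≤ R) :
    R < 3 ^ (⌈√(Real.log R)⌉₊ * ⌈√(Real.log R)⌉₊) := by
  set s := ⌈√(Real.log R)⌉₊
  have hR' : (1 : ℝ) < R := by exact_mod_cast hR
  have hL : 0 < Real.log R := Real.log_pos hR'
  have h1 : Real.log R ≤ (s * s : ℕ) := by
    have h2 := Nat.le_ceil (√(Real.log R))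
    push_cast
    calc Real.log R = √(Real.log R) * √(Real.log R) := (Real.mul_self_sqrt hL.le).symm
      _ ≤ s * s := by gcongr
  have h3 : s * s ≠ 0 := by
    intro h
    rw [h] at h1
    simp at h1
    linarith
  have h4 : (R : ℝ) < 3 ^ (s * s) := by
    calc (R : ℝ) = Real.exp (Real.log R) := (Real.exp_log (by linarith)).symm
      _ ≤ Real.exp (s * s : ℕ) := Real.exp_le_exp.2 h1
      _ = Real.exp 1 ^ (s * s) := (Real.exp_one_pow _).symm
      _ < 3 ^ (s * s) := pow_lt_pow_left₀ Real.exp_one_lt_three (Real.exp_pos 1).le h3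
  exact_mod_cast h4

end SixthOrderCorrelation

/-- sixth-order correlations of lattice points on circles. For every `κ > 0`
there are `ε, C > 0` and `R₀` such that for all integers `R ≥ R₀`, if
`A = {(x,y) ∈ ℤ² : x² + y² = R}` satisfies `|A| > exp((log R)^{1-ε})`, then the number of
six-tuples in `A⁶` with `z₁ + z₂ + z₃ = z₄ + z₅ + z₆` is at most `C |A|^{3+κ}`. -/
theorem sixth_order_correlation :
    ∀ κ : ℝ, 0 < κ → ∃ ε C : ℝ, 0 < ε ∧ 0 < C ∧ ∃ R₀ : ℕ, 0 < R₀ ∧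
      ∀ R : ℕ, R₀ ≤ R →
        Real.exp (Real.log R ^ (1 - ε)) <
            (Nat.card {z : ℤ × ℤ // z.1 ^ 2 + z.2 ^ 2 = (R : ℤ)} : ℝ) →
        (Nat.card {z : Fin 6 → ℤ × ℤ //
              (∀ i, (z i).1 ^ 2 + (z i).2 ^ 2 = (R : ℤ)) ∧
              z 0 + z 1 + z 2 = z 3 + z 4 + z 5} : ℝ) ≤
          C * (Nat.card {z : ℤ × ℤ // z.1 ^ 2 + z.2 ^ 2 = (R : ℤ)} : ℝ) ^ (3 + κ) := by
  intro κ hκ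
  obtain ⟨R₁, hR₁⟩ := Filter.eventually_atTop.1 (eventually_exp_le_exp_rpow (half_pos hκ))
  refine ⟨1 / 4, 2 ^ 22 * (2 / (κ / 2) + 1), by norm_num, by positivity, max 4 R₁, by simp,
    fun R hR hA => ?_⟩
  rw [Nat.subtype_card (circlePoints R) fun z => mem_circlePoints] at hA ⊢
  rw [Nat.subtype_card ((Fintype.piFinset fun _ : Fin 6 => circlePoints R).filter
    fun z => z 0 + z 1 + z 2 = z 3 + z 4 + z 5) (by simp [mem_circlePoints])]
  have hR4 : 4 ≤ R := (le_max_left _ _).trans hR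
  set n := (circlePoints R).card
  have hn : (0 : ℝ) < n := (Real.exp_pos _).trans hA
  have h1 := natLog_add_one_le_rpow (half_pos hκ) (n := n) (by exact_mod_cast hn.ne')
  have h2 : Real.exp (60 * ⌈√(Real.log R)⌉₊) ≤ (n : ℝ) ^ (κ / 2) :=
    (hR₁ R ((le_max_right _ _).trans hR)).trans
      (Real.rpow_le_rpow (Real.exp_pos _).le hA.le (half_pos hκ).le)
  calc _ ≤ 2 ^ 22 * (Nat.log 2 n + 1) * Real.exp (60 * ⌈√(Real.log R)⌉₊) * (n : ℝ) ^ 3 :=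
        card_filter_circlePoints_le hR4 (lt_three_pow_ceil_sqrt_log (by omega))
    _ ≤ 2 ^ 22 * ((2 / (κ / 2) + 1) * (n : ℝ) ^ (κ / 2)) * (n : ℝ) ^ (κ / 2) * (n : ℝ) ^ 3 := by
        gcongr
    _ = _ := by
        rw [show 3 + κ = κ / 2 + κ / 2 + (3 : ℕ) by push_cast; ring,
          Real.rpow_add hn, Real.rpow_add hn, Real.rpow_natCast]
        ring
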